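/- arXiv:1904.07281 — 5 statements merged into one kernel-verified Lean document; each statement's English description precedes it below -/
import Mathlib

section
/- Let k be an algebraically closed field of characteristic zero and let g be a Lie algebra over k of dimension 3 that is not abelian. Then the universal enveloping algebra U(g) is strongly cancellative: for every n ≥ 1 and every k-algebra B, every k-algebra isomorphism U(g) ⊗_k k[t_1,…,t_n] ≅ B ⊗_k k[t_1,…,t_n] implies U(g) ≅ B as k-algebras. -/
open scoped TensorProduct

universe u

/-- A `k`-algebra `A` is strongly cancellative if for every `n ≥ 1` and every `k`-algebra
`B`, every `k`-algebra isomorphism `A ⊗[k] k[t₁,…,tₙ] ≅ B ⊗[k] k[t₁,…,tₙ]` implies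
`A ≅ B` as `k`-algebras. -/
def StronglyCancellative (k : Type u) [Field k] (A : Type u) [Ring A] [Algebra k A] : Prop :=
  ∀ (n : ℕ), 1 ≤ n → ∀ (B : Type u) [Ring B] [Algebra k B],
    Nonempty ((A ⊗[k] MvPolynomial (Fin n) k) ≃ₐ[k] (B ⊗[k] MvPolynomial (Fin n) k)) →
    Nonempty (A ≃ₐ[k] B)

namespace Cancel

section Descent

open Algebra.TensorProduct

variable {k : Type u} [Field k] {A B T : Type u} [Ring A] [Algebra k A] [Ring B] [Algebra k B]
  [CommRing T] [Algebra k T]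

/-- Specialisation of the parameters in `T` at a `k`-point. -/
noncomputable def specialize (A : Type u) [Ring A] [Algebra k A] (ev : T →ₐ[k] k) :
    A ⊗[k] T →ₐ[k] A :=
  (Algebra.TensorProduct.rid k k A).toAlgHom.comp (Algebra.TensorProduct.map (AlgHom.id k A) ev)

@[simp] lemma specialize_tmul (ev : T →ₐ[k] k) (a : A) (t : T) :
    specialize A ev (a ⊗ₜ t) = ev t • a := by
  simp [specialize]

/-- An isomorphism `A ⊗ T ≃ B ⊗ T` which is the identity on `T` descends to `A ≃ B`. -/
lemma nonempty_algEquiv_of_fix (ev : T →ₐ[k] k) (θ : (A ⊗[k] T) ≃ₐ[k] (B ⊗[k] T))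
    (hθ : ∀ t : T, θ (1 ⊗ₜ t) = 1 ⊗ₜ t) : Nonempty (A ≃ₐ[k] B) := by
  have key : ∀ (A B : Type u) [Ring A] [Ring B] [Algebra k A] [Algebra k B]
      (θ : (A ⊗[k] T) →ₐ[k] (B ⊗[k] T)) (_ : ∀ t : T, θ (1 ⊗ₜ t) = 1 ⊗ₜ t) (x : A ⊗[k] T),
      specialize B ev (θ (specialize A ev x ⊗ₜ 1)) = specialize B ev (θ x) := by
    intro A B _ _ _ _ θ hθ x
    have : ((specialize B ev).comp θ).comp (includeLeft.comp (specialize A ev)) =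
        (specialize B ev).comp θ := by
      ext t
      · simp
      · simp only [AlgHom.coe_comp, Function.comp_apply, includeRight_apply, specialize_tmul,
          AlgHom.restrictScalars_apply, hθ]
        simp [← one_def]
    exact DFunLike.congr_fun this x
  have hθ' : ∀ t : T, θ.symm (1 ⊗ₜ t) = 1 ⊗ₜ t := fun t => by rw [← hθ, θ.symm_apply_apply]
  refine ⟨AlgEquiv.ofAlgHom ((specialize B ev).comp (θ.toAlgHom.comp includeLeft))
    ((specialize A ev).comp (θ.symm.toAlgHom.comp includeLeft)) ?_ ?_⟩
  · ext b
    simpa using key A B θ.toAlgHom hθ (θ.symm (b ⊗ₜ 1))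
  · ext a
    simpa using key B A θ.symm.toAlgHom hθ' (θ (a ⊗ₜ 1))

variable {C D : Type u} [CommRing C] [Algebra k C] [CommRing D] [Algebra k D]

lemma nonempty_algEquiv_of_extension (ev : T →ₐ[k] k) (d : D →ₐ[k] A) (c : C →ₐ[k] B)
    (σ : (A ⊗[k] T) ≃ₐ[k] (B ⊗[k] T)) (τ : (D ⊗[k] T) ≃ₐ[k] (C ⊗[k] T))
    (hστ : ∀ x, σ (map d (AlgHom.id k T) x) = map c (AlgHom.id k T) (τ x))
    (δ : D ≃ₐ[k] C) (ψ : (A ⊗[k] T) ≃ₐ[k] (A ⊗[k] T))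
    (hψ : ∀ x, ψ (map d (AlgHom.id k T) x) =
      map d (AlgHom.id k T) (Algebra.TensorProduct.congr δ.symm AlgEquiv.refl (τ x))) :
    Nonempty (A ≃ₐ[k] B) := by
  refine nonempty_algEquiv_of_fix ev (ψ.symm.trans σ) fun t => ?_
  have h := hψ (τ.symm (1 ⊗ₜ t))
  have h' : map d (AlgHom.id k T) (Algebra.TensorProduct.congr δ.symm AlgEquiv.refl
      (1 ⊗ₜ[k] t)) = 1 ⊗ₜ t := by simp
  rw [τ.apply_symm_apply, h'] at h
  rw [AlgEquiv.trans_apply, ← h, AlgEquiv.symm_apply_apply, hστ]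
  simp

/-- A `D`-linear automorphism of `D ⊗ T` extends to `A ⊗ T` when `D` maps to the centre of `A`. -/
lemma exists_extension_of_fix (d : D →ₐ[k] A) (hd : ∀ x a, Commute (d x) a)
    (τ : (D ⊗[k] T) ≃ₐ[k] (D ⊗[k] T)) (hτ : ∀ x : D, τ (x ⊗ₜ 1) = x ⊗ₜ 1) :
    ∃ ψ : (A ⊗[k] T) ≃ₐ[k] (A ⊗[k] T),
      ∀ x, ψ (map d (AlgHom.id k T) x) = map d (AlgHom.id k T) (τ x) := by
  have comm : ∀ (a : A) (x : D ⊗[k] T),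
      Commute (a ⊗ₜ[k] (1 : T)) (map d (AlgHom.id k T) x) := by
    intro a x
    induction x with
    | zero => simp
    | add x y hx hy => rw [map_add]; exact hx.add_right hy
    | tmul x t =>
      simp [Commute, SemiconjBy, (hd x a).eq]
  let L (τ : (D ⊗[k] T) →ₐ[k] (D ⊗[k] T)) : (A ⊗[k] T) →ₐ[k] (A ⊗[k] T) :=
    Algebra.TensorProduct.lift (includeLeft : A →ₐ[k] A ⊗[k] T)
      ((map d (AlgHom.id k T)).comp (τ.comp includeRight)) fun a t => comm a _
  have hl (τ : (D ⊗[k] T) →ₐ[k] (D ⊗[k] T)) (a : A) : L τ (a ⊗ₜ 1) = a ⊗ₜ 1 :=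
    (lift_tmul _ _ _ _ _).trans (by simp [← one_def])
  have hr (τ : (D ⊗[k] T) →ₐ[k] (D ⊗[k] T)) (t : T) :
      L τ (1 ⊗ₜ t) = map d (AlgHom.id k T) (τ (1 ⊗ₜ t)) :=
    (lift_tmul _ _ _ _ _).trans (by simp [← one_def])
  have hL : ∀ (τ : (D ⊗[k] T) →ₐ[k] (D ⊗[k] T)) (_ : ∀ x : D, τ (x ⊗ₜ 1) = x ⊗ₜ 1) x,
      L τ (map d (AlgHom.id k T) x) = map d (AlgHom.id k T) (τ x) := by
    intro τ hτ x
    have : (L τ).comp (map d (AlgHom.id k T)) = (map d (AlgHom.id k T)).comp τ := by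
      ext x
      · simp [hl, hτ]
      · simp [hr]
    exact DFunLike.congr_fun this x
  have hτ' : ∀ x : D, τ.symm (x ⊗ₜ 1) = x ⊗ₜ 1 := fun x => by
    rw [← hτ, τ.symm_apply_apply, hτ]
  have inv : ∀ τ τ' : (D ⊗[k] T) →ₐ[k] (D ⊗[k] T), (∀ x : D, τ (x ⊗ₜ 1) = x ⊗ₜ 1) →
      τ.comp τ' = AlgHom.id k _ → (L τ).comp (L τ') = AlgHom.id k _ := by
    intro τ τ' hτ h
    ext x
    · simp [hl]
    · have h2 := DFunLike.congr_fun h (1 ⊗ₜ x)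
      have h3 := hL τ hτ (τ' (1 ⊗ₜ x))
      simp only [AlgHom.coe_comp, Function.comp_apply, AlgHom.id_apply] at h2
      rw [h2] at h3
      simpa [hr] using h3
  refine ⟨AlgEquiv.ofAlgHom (L τ) (L τ.symm) (inv _ _ hτ ?_) (inv _ _ hτ' ?_), hL τ hτ⟩
  · ext <;> simp
  · ext <;> simp

end Descent

section Commutative

open MvPolynomial

lemma injective_of_surjective_of_isNoetherianRing {R : Type*} [CommRing R] [IsNoetherianRing R]
    (f : R →+* R) (hf : Function.Surjective f) : Function.Injective f := by
  have hmono : Monotone fun n => RingHom.ker (f ^ n) := by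
    refine monotone_nat_of_le_succ fun n x hx => ?_
    rw [RingHom.mem_ker] at hx ⊢
    rw [pow_succ', RingHom.mul_def, RingHom.comp_apply, hx, map_zero]
  obtain ⟨n, hn⟩ := monotone_stabilizes_iff_noetherian.mpr ‹IsNoetherianRing R› ⟨_, hmono⟩
  rw [injective_iff_map_eq_zero]
  intro x hx
  have hsurj : Function.Surjective (f ^ n) := by
    rw [RingHom.coe_pow]; exact hf.iterate n
  obtain ⟨y, rfl⟩ := hsurj x
  have : y ∈ RingHom.ker (f ^ (n + 1)) := by
    rw [RingHom.mem_ker, pow_succ', RingHom.mul_def, RingHom.comp_apply, hx]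
  have h2 := hn (n + 1) n.le_succ
  simp only [OrderHom.coe_mk] at h2
  rwa [← h2] at this

variable {k : Type u} [Field k]

/-- A subalgebra `C` of a polynomial ring having a nonconstant `p` with `C = k + p C`
is the polynomial ring `k[p]`. -/
lemma aeval_bijective_of_forall_exists {C : Type*} [CommRing C] [Algebra k C] {ι : Type*}
    (j : C →ₐ[k] MvPolynomial ι k) (hj : Function.Injective j) (p : C)
    (hp : (j p).totalDegree ≠ 0)
    (h : ∀ c : C, ∃ (a : k) (c' : C), c = algebraMap k C a + p * c') :
    Function.Bijective (Polynomial.aeval p : Polynomial k →ₐ[k] C) := by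
  have hp0 : j p ≠ 0 := fun h0 => hp (by rw [h0, totalDegree_zero])
  constructor
  · rw [injective_iff_map_eq_zero]
    suffices ∀ (N : ℕ) (f : Polynomial k), f.natDegree ≤ N → Polynomial.aeval p f = 0 → f = 0 from
      fun f hf => this _ f le_rfl hf
    intro N
    induction N with
    | zero =>
      intro f hN hf
      rw [Polynomial.eq_C_of_natDegree_le_zero hN, Polynomial.aeval_C] at hf
      have := congrArg j hf
      rw [AlgHom.commutes, map_zero, algebraMap_eq, C_eq_zero] at this
      rw [Polynomial.eq_C_of_natDegree_le_zero hN, this, map_zero]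
    | succ N ih =>
      intro f hN hf
      have hf' := hf
      rw [← Polynomial.X_mul_divX_add f, map_add, map_mul, Polynomial.aeval_X,
        Polynomial.aeval_C] at hf'
      have h1 := congrArg j hf'
      rw [map_add, map_mul, AlgHom.commutes, map_zero, algebraMap_eq] at h1
      have h2 : j (Polynomial.aeval p f.divX) = 0 := by
        by_contra hne
        have := totalDegree_mul_of_isDomain hp0 hne
        rw [eq_neg_of_add_eq_zero_left h1, totalDegree_neg, totalDegree_C] at this
        omega
      rw [h2, mul_zero, zero_add, C_eq_zero] at h1
      have h3 := ih f.divX (by rw [Polynomial.natDegree_divX_eq_natDegree_tsub_one]; omega)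
        (hj (by rw [h2, map_zero]))
      rw [← Polynomial.X_mul_divX_add f, h3, h1, mul_zero, map_zero, add_zero]
  · suffices ∀ (N : ℕ) (c : C), (j c).totalDegree ≤ N →
        c ∈ (Polynomial.aeval p : Polynomial k →ₐ[k] C).range from fun c => this _ c le_rfl
    intro N
    induction N with
    | zero =>
      intro c hc
      rw [Nat.le_zero, totalDegree_eq_zero_iff_eq_C, ← algebraMap_eq, ← j.commutes] at hc
      rw [hj hc]
      exact Subalgebra.algebraMap_mem _ _
    | succ N ih =>
      intro c hc
      obtain ⟨a, c', rfl⟩ := h c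
      refine Subalgebra.add_mem _ (Subalgebra.algebraMap_mem _ _)
        (Subalgebra.mul_mem _ ⟨Polynomial.X, by simp⟩ ?_)
      by_cases h0 : j c' = 0
      · rw [hj (h0.trans (map_zero j).symm)]; exact Subalgebra.zero_mem _
      · refine ih c' ?_
        have h1 := totalDegree_mul_of_isDomain hp0 h0
        have h2 : j p * j c' = j (algebraMap k C a + p * c') - MvPolynomial.C a := by
          rw [map_add, map_mul, AlgHom.commutes, algebraMap_eq]; ring
        have h3 := totalDegree_sub (j (algebraMap k C a + p * c')) (MvPolynomial.C a)
        rw [← h2, totalDegree_C, h1] at h3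
        omega

variable {n : ℕ} {C : Type u} [CommRing C] [Algebra k C]

lemma exists_rename_some_add (f : MvPolynomial (Option (Fin n)) k) :
    ∃ (a : MvPolynomial (Fin n) k) (b : MvPolynomial (Option (Fin n)) k),
      f = rename some a + X none * b := by
  induction f using MvPolynomial.induction_on with
  | C r => exact ⟨MvPolynomial.C r, 0, by simp⟩
  | add f g hf hg =>
    obtain ⟨a, b, rfl⟩ := hf
    obtain ⟨a', b', rfl⟩ := hg
    exact ⟨a + a', b + b', by rw [map_add]; ring⟩
  | mul_X f i hf =>
    obtain ⟨a, b, rfl⟩ := hf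
    cases i with
    | none => exact ⟨0, rename some a + X none * b, by simp; ring⟩
    | some i => exact ⟨a * X i, b * X (some i), by simp; ring⟩

lemma isDomain_of_equiv {ι : Type*} {R : Type*} [CommRing R] [IsDomain R]
    (β : R ≃+* MvPolynomial ι C) : IsDomain C := by
  have : IsDomain (MvPolynomial ι C) := β.toMulEquiv.symm.isDomain
  exact (MvPolynomial.C_injective ι C).isDomain (MvPolynomial.C : C →+* MvPolynomial ι C)

lemma eq_C_of_mul_eq_C [IsDomain C] {ι : Type*} {f g : MvPolynomial ι C} {c : C} (hc : c ≠ 0)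
    (h : f * g = MvPolynomial.C c) : ∃ z, f = MvPolynomial.C z := by
  have hfg : f * g ≠ 0 := by rw [h]; simpa using hc
  have := totalDegree_mul_of_isDomain (left_ne_zero_of_mul hfg) (right_ne_zero_of_mul hfg)
  rw [h, totalDegree_C] at this
  exact ⟨_, totalDegree_eq_zero_iff_eq_C.mp (by omega)⟩

/-- If `k[x, t] ≃ C[s]` and a character of `C` kills `x`, then `C = k[x]`. -/
lemma exists_C_eq_of_map_eq_zero (β : MvPolynomial (Option (Fin n)) k ≃ₐ[k] MvPolynomial (Fin n) C)
    (χ : C →ₐ[k] k) (h : MvPolynomial.map χ.toRingHom (β (X none)) = 0) :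
    ∃ z : C, β (X none) = MvPolynomial.C z ∧
      Function.Bijective (Polynomial.aeval z : Polynomial k →ₐ[k] C) := by
  have : IsDomain C := isDomain_of_equiv β.toRingEquiv
  have hχ : Function.Surjective χ := fun a => ⟨algebraMap k C a, by simp⟩
  let ρ : MvPolynomial (Option (Fin n)) k →+* MvPolynomial (Fin n) k :=
    (MvPolynomial.map χ.toRingHom).comp β.toRingEquiv.toRingHom
  have hρ : Function.Surjective ρ :=
    (MvPolynomial.map_surjective χ.toRingHom hχ).comp β.surjective
  have hρX : ρ (X none) = 0 := h
  have hinj : Function.Injective (ρ.comp (rename some).toRingHom) := by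
    apply injective_of_surjective_of_isNoetherianRing
    intro t
    obtain ⟨f, rfl⟩ := hρ t
    obtain ⟨a, b, rfl⟩ := exists_rename_some_add f
    exact ⟨a, by simp [hρX]⟩
  have hker : ∀ f, ρ f = 0 → ∃ b, f = X none * b := by
    intro f hf
    obtain ⟨a, b, rfl⟩ := exists_rename_some_add f
    refine ⟨b, ?_⟩
    rw [map_add, map_mul, hρX, zero_mul, add_zero] at hf
    have : a = 0 := hinj (by simpa using hf)
    rw [this, map_zero, zero_add]
  have hdvd : ∀ u, χ u = 0 → ∃ b, MvPolynomial.C u = β (X none) * b := by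
    intro u hu
    obtain ⟨b, hb⟩ := hker (β.symm (MvPolynomial.C u)) (by simp [ρ, hu])
    exact ⟨β b, by rw [← map_mul, ← hb, AlgEquiv.apply_symm_apply]⟩
  obtain ⟨u, hu, hu0⟩ : ∃ u, χ u = 0 ∧ u ≠ 0 := by
    by_contra! hcon
    have hχi : Function.Injective χ.toRingHom :=
      (injective_iff_map_eq_zero _).2 hcon
    have := MvPolynomial.map_injective (σ := Fin n) _ hχi (h.trans (map_zero _).symm)
    exact X_ne_zero none (β.injective (this.trans (map_zero β).symm))
  obtain ⟨b, hb⟩ := hdvd u hu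
  obtain ⟨z, hz⟩ := eq_C_of_mul_eq_C hu0 hb.symm
  refine ⟨z, hz, aeval_bijective_of_forall_exists
    (β.symm.toAlgHom.comp (IsScalarTower.toAlgHom k C (MvPolynomial (Fin n) C)))
    (β.symm.injective.comp (MvPolynomial.C_injective _ _)) z ?_ fun c => ?_⟩
  · have : β.symm (MvPolynomial.C z) = X none := by rw [← hz, AlgEquiv.symm_apply_apply]
    simp [algebraMap_eq, this]
  · obtain ⟨b, hb⟩ := hdvd (c - algebraMap k C (χ c)) (by simp)
    refine ⟨χ c, constantCoeff b, ?_⟩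
    have := congrArg constantCoeff hb
    rw [hz, map_mul, constantCoeff_C, constantCoeff_C] at this
    rw [← this]; ring

/-- If `k[t] ≃ C[s]` then `C = k`. -/
lemma algebraMap_bijective_of_equiv (β : MvPolynomial (Fin n) k ≃ₐ[k] MvPolynomial (Fin n) C) :
    Function.Bijective (algebraMap k C) := by
  let χ : C →ₐ[k] k := (aeval (fun _ => (0 : k))).comp
    (β.symm.toAlgHom.comp (IsScalarTower.toAlgHom k C (MvPolynomial (Fin n) C)))
  have hχ : Function.Surjective χ := fun a => ⟨algebraMap k C a, by rw [AlgHom.commutes]; rfl⟩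
  have hinj : Function.Injective
      ((MvPolynomial.map (σ := Fin n) χ.toRingHom).comp β.toRingEquiv.toRingHom) :=
    injective_of_surjective_of_isNoetherianRing _
      ((MvPolynomial.map_surjective χ.toRingHom hχ).comp β.surjective)
  have hχi : Function.Injective χ := by
    intro a b hab
    apply MvPolynomial.C_injective (Fin n) C
    apply β.symm.injective
    apply hinj
    simpa using congrArg (MvPolynomial.C (σ := Fin n)) hab
  have : Nontrivial C := hχ.nontrivial
  exact ⟨(algebraMap k C).injective, fun c => ⟨χ c, hχi (by simp)⟩⟩

/-- If `x` and a prime `p` of the domain `C` are algebraically dependent over the algebraically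
closed field `k`, then `x` is constant modulo `p`. -/
lemma exists_dvd_sub_of_dependent [IsAlgClosed k] {p x : C} (hp : Prime p)
    (P : Polynomial (Polynomial k)) (hP : P ≠ 0)
    (h : Polynomial.eval₂ (Polynomial.aeval (R := k) x).toRingHom p P = 0) [IsDomain C] :
    ∃ a : k, p ∣ x - algebraMap k C a := by
  obtain ⟨Q, hPQ, hQ⟩ := Polynomial.exists_eq_pow_rootMultiplicity_mul_and_not_dvd P hP 0
  rw [hPQ, Polynomial.eval₂_mul, Polynomial.eval₂_pow] at h
  simp only [map_zero, sub_zero, Polynomial.eval₂_X] at h hQ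
  have h1 := (mul_eq_zero.mp h).resolve_left (pow_ne_zero _ hp.ne_zero)
  rw [Polynomial.X_dvd_iff] at hQ
  rw [← Polynomial.X_mul_divX_add Q, Polynomial.eval₂_add, Polynomial.eval₂_mul,
    Polynomial.eval₂_X, Polynomial.eval₂_C] at h1
  have h2 : p ∣ Polynomial.aeval x (Q.coeff 0) :=
    ⟨-Polynomial.eval₂ (Polynomial.aeval (R := k) x).toRingHom p Q.divX,
      by rw [mul_neg]; exact eq_neg_of_add_eq_zero_right h1⟩
  have hs := IsAlgClosed.splits (Q.coeff 0)
  rw [hs.eq_prod_roots, map_mul, Polynomial.aeval_C, map_multiset_prod,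
    Multiset.map_map] at h2
  rcases hp.dvd_or_dvd h2 with h3 | h3
  · exact absurd (isUnit_of_dvd_unit h3
      ((Ne.isUnit (by simpa using hQ)).map (algebraMap k C))) hp.not_isUnit
  · obtain ⟨a, -, hd⟩ := hp.exists_mem_multiset_map_dvd h3
    exact ⟨a, by simpa using hd⟩

lemma exists_algebraic_relation (β : MvPolynomial (Option (Fin n)) k ≃ₐ[k] MvPolynomial (Fin n) C)
    (p x : C) : ∃ P : Polynomial (Polynomial k), P ≠ 0 ∧
      Polynomial.eval₂ (Polynomial.aeval (R := k) x).toRingHom p P = 0 := by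
  have : IsDomain C := isDomain_of_equiv β.toRingEquiv
  have h1 : Algebra.trdeg k C = 1 := by
    have h := trdeg_add_eq k C (A := MvPolynomial (Fin n) C)
    rw [← β.trdeg_eq, MvPolynomial.trdeg_of_isDomain, MvPolynomial.trdeg_of_isDomain] at h
    simp only [Cardinal.mk_fintype, Fintype.card_option, Fintype.card_fin, Cardinal.lift_natCast,
      Nat.cast_add, Nat.cast_one, Cardinal.lift_add, Cardinal.lift_one] at h
    rw [add_comm] at h
    exact Cardinal.eq_of_add_eq_add_left h (Cardinal.natCast_lt_aleph0)
  have h2 : ¬ AlgebraicIndependent k (fun o : Option PUnit.{u + 1} => o.elim p fun _ => x) := by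
    intro hind
    have := hind.cardinalMk_le_trdeg
    rw [h1] at this
    simp at this
  rw [algebraicIndependent_iff] at h2
  push Not at h2
  obtain ⟨q, hq, hq0⟩ := h2
  refine ⟨(optionEquivLeft k PUnit q).map (uniqueAlgEquiv k PUnit).toRingHom, ?_, ?_⟩
  · rw [Ne, Polynomial.map_eq_zero_iff (uniqueAlgEquiv k PUnit).injective]
    simpa using hq0
  · rw [← hq, Polynomial.eval₂_map]
    clear hq hq0
    induction q using MvPolynomial.induction_on with
    | C a => simp [optionEquivLeft_C]
    | add f g hf hg => rw [map_add, Polynomial.eval₂_add, hf, hg, map_add]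
    | mul_X f i hf =>
      rw [map_mul, Polynomial.eval₂_mul, hf, map_mul, aeval_X]
      congr 1
      cases i <;> simp [optionEquivLeft_X_none, optionEquivLeft_X_some]

/-- One-variable polynomial rings are cancellative. -/
lemma nonempty_polynomial_equiv [IsAlgClosed k]
    (β : MvPolynomial (Option (Fin n)) k ≃ₐ[k] MvPolynomial (Fin n) C) :
    Nonempty (Polynomial k ≃ₐ[k] C) := by
  have : IsDomain C := isDomain_of_equiv β.toRingEquiv
  have hUF : UniqueFactorizationMonoid (MvPolynomial (Fin n) C) :=
    β.toMulEquiv.uniqueFactorizationMonoid inferInstance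
  let j : C →ₐ[k] MvPolynomial (Option (Fin n)) k :=
    β.symm.toAlgHom.comp (IsScalarTower.toAlgHom k C (MvPolynomial (Fin n) C))
  have hj : Function.Injective j := β.symm.injective.comp (MvPolynomial.C_injective _ _)
  let χ : C →ₐ[k] k := (aeval (fun _ => (0 : k))).comp j
  obtain ⟨c, hc, hc0⟩ : ∃ c, χ c = 0 ∧ c ≠ 0 := by
    by_contra! hcon
    have hχi : Function.Injective χ := (injective_iff_map_eq_zero _).2 hcon
    let γ : C ≃ₐ[k] k := AlgEquiv.ofBijective χ ⟨hχi, fun a => ⟨algebraMap k C a, by simp⟩⟩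
    have h := (β.trans (MvPolynomial.mapAlgEquiv (Fin n) γ)).trdeg_eq
    rw [MvPolynomial.trdeg_of_isDomain, MvPolynomial.trdeg_of_isDomain] at h
    simp only [Cardinal.mk_fintype, Fintype.card_option, Fintype.card_fin,
      Cardinal.lift_natCast, Nat.cast_inj] at h
    omega
  have hcu : ¬ IsUnit (MvPolynomial.C (σ := Fin n) c) := by
    intro hu
    have := (hu.map (constantCoeff)).map χ
    rw [constantCoeff_C, hc] at this
    exact not_isUnit_zero this
  obtain ⟨q, hq, hqc⟩ := WfDvdMonoid.exists_irreducible_factor hcu (by simpa using hc0)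
  obtain ⟨r, hr⟩ := hqc
  obtain ⟨p, rfl⟩ := eq_C_of_mul_eq_C hc0 hr.symm
  have hp : Prime p := (MvPolynomial.prime_C_iff _).mp hq.prime
  refine ⟨AlgEquiv.ofBijective _ (aeval_bijective_of_forall_exists j hj p ?_ fun u => ?_)⟩
  · intro h0
    rw [totalDegree_eq_zero_iff_eq_C, ← algebraMap_eq, ← j.commutes] at h0
    have h1 := hj h0
    by_cases h2 : coeff 0 (j p) = 0
    · exact hp.ne_zero (by rw [h1, h2, map_zero])
    · exact hp.not_isUnit (by rw [h1]; exact (Ne.isUnit h2).map _)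
  · obtain ⟨P, hP, hP0⟩ := exists_algebraic_relation β p u
    obtain ⟨a, b, hb⟩ := exists_dvd_sub_of_dependent hp P hP hP0
    exact ⟨a, b, by rw [← hb]; ring⟩

end Commutative

section Criteria

open Algebra.TensorProduct

variable {k : Type u} [Field k] {A B D C T : Type u} [Ring A] [Algebra k A] [Ring B] [Algebra k B]
  [CommRing D] [Algebra k D] [CommRing C] [Algebra k C] [CommRing T] [Algebra k T]

lemma map_id_injective {c : C →ₐ[k] B} (hc : Function.Injective c) :
    Function.Injective (map c (AlgHom.id k T)) :=
  Module.Flat.rTensor_preserves_injective_linearMap (M := T) c.toLinearMap hc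

lemma commute_of_range_eq_center {c : C →ₐ[k] B} (hc : c.range = Subalgebra.center k B) (x : C)
    (b : B) : Commute (c x) b := by
  have : c x ∈ Subalgebra.center k B := by rw [← hc]; exact ⟨x, rfl⟩
  exact (Subalgebra.mem_center_iff.mp this b).symm

lemma range_map_id_eq_center {c : C →ₐ[k] B} (hc : c.range = Subalgebra.center k B) :
    (map c (AlgHom.id k T)).range = Subalgebra.center k (B ⊗[k] T) := by
  apply le_antisymm
  · rintro _ ⟨x, rfl⟩
    rw [Subalgebra.mem_center_iff]
    intro b
    change b * map c (AlgHom.id k T) x = map c (AlgHom.id k T) x * b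
    induction b with
    | zero => simp
    | add b b' h h' => rw [add_mul, mul_add, h, h']
    | tmul b t =>
      induction x with
      | zero => simp
      | add x x' h h' => rw [map_add, add_mul, mul_add, h, h']
      | tmul x s => simp [(commute_of_range_eq_center hc x b).eq, mul_comm s t]
  · intro y hy
    have h1 : y ∈ Subalgebra.centralizer k
        ((includeLeft : B →ₐ[k] B ⊗[k] T).range : Set (B ⊗[k] T)) := by
      rw [Subalgebra.mem_centralizer_iff]
      exact fun z _ => Subalgebra.mem_center_iff.mp hy z
    rw [Subalgebra.centralizer_coe_range_includeLeft_eq_center_tensorProduct] at h1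
    obtain ⟨x, rfl⟩ := h1
    clear hy
    change map (Subalgebra.center k B).val (AlgHom.id k T) x ∈ _
    induction x with
    | zero => rw [map_zero]; exact Subalgebra.zero_mem _
    | add x x' h h' =>
      rw [map_add]
      exact Subalgebra.add_mem _ h h'
    | tmul x t =>
      obtain ⟨z, hz⟩ : (x : B) ∈ c.range := by rw [hc]; exact x.2
      exact ⟨z ⊗ₜ t, by simpa using congrArg (· ⊗ₜ[k] t) hz⟩

lemma exists_equiv_of_injective_of_range_eq {S S' : Type*} [Ring S] [Algebra k S] [Ring S']
    [Algebra k S'] {P : Type*} [Ring P] [Algebra k P] {f : S →ₐ[k] P} {g : S' →ₐ[k] P}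
    (hf : Function.Injective f) (hg : Function.Injective g) (h : f.range = g.range) :
    ∃ τ : S ≃ₐ[k] S', ∀ x, f x = g (τ x) := by
  refine ⟨((AlgEquiv.ofInjective f hf).trans (Subalgebra.equivOfEq _ _ h)).trans
    (AlgEquiv.ofInjective g hg).symm, fun x => ?_⟩
  have := congrArg Subtype.val ((AlgEquiv.ofInjective g hg).apply_symm_apply
    (Subalgebra.equivOfEq _ _ h (AlgEquiv.ofInjective f hf x)))
  exact this.symm

/-- An isomorphism `A ⊗ T ≃ B ⊗ T` restricts to the centres. -/
lemma exists_center_equiv {d : D →ₐ[k] A} (hd : Function.Injective d)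
    (hdr : d.range = Subalgebra.center k A) {c : C →ₐ[k] B} (hc : Function.Injective c)
    (hcr : c.range = Subalgebra.center k B) (σ : (A ⊗[k] T) ≃ₐ[k] (B ⊗[k] T)) :
    ∃ τ : (D ⊗[k] T) ≃ₐ[k] (C ⊗[k] T),
      ∀ x, σ (map d (AlgHom.id k T) x) = map c (AlgHom.id k T) (τ x) := by
  refine exists_equiv_of_injective_of_range_eq
    (f := σ.toAlgHom.comp (map d (AlgHom.id k T)))
    (σ.injective.comp (map_id_injective hd)) (map_id_injective hc) ?_
  rw [range_map_id_eq_center hcr]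
  ext y
  have hmem (x : A ⊗[k] T) : x ∈ Subalgebra.center k (A ⊗[k] T) ↔
      σ x ∈ Subalgebra.center k (B ⊗[k] T) := by
    simp only [Subalgebra.mem_center_iff]
    refine ⟨fun h b => ?_, fun h a => σ.injective ?_⟩
    · rw [← σ.apply_symm_apply b, ← map_mul, h, map_mul]
    · rw [map_mul, h, map_mul]
  rw [← σ.apply_symm_apply y, ← hmem, ← range_map_id_eq_center hdr]
  constructor
  · rintro ⟨x, hx⟩; exact ⟨x, σ.injective hx⟩
  · rintro ⟨x, hx⟩; exact ⟨x, congrArg σ hx⟩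

/-- If the isomorphism of centres maps `D` to `C`, then it is no restriction that `T` is fixed. -/
lemma nonempty_algEquiv_of_center (ev : T →ₐ[k] k) {d : D →ₐ[k] A}
    (hdr : d.range = Subalgebra.center k A) (c : C →ₐ[k] B) (σ : (A ⊗[k] T) ≃ₐ[k] (B ⊗[k] T))
    (τ : (D ⊗[k] T) ≃ₐ[k] (C ⊗[k] T))
    (hστ : ∀ x, σ (map d (AlgHom.id k T) x) = map c (AlgHom.id k T) (τ x))
    (δ : D ≃ₐ[k] C) (hδ : ∀ x : D, τ (x ⊗ₜ 1) = δ x ⊗ₜ 1) : Nonempty (A ≃ₐ[k] B) := by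
  obtain ⟨ψ, hψ⟩ := exists_extension_of_fix d (commute_of_range_eq_center hdr)
    (τ.trans (Algebra.TensorProduct.congr δ.symm AlgEquiv.refl)) (fun x => by simp [hδ])
  exact nonempty_algEquiv_of_extension ev d c σ τ hστ δ ψ hψ

variable {n : ℕ}

/-- `C ⊗ k[t] ≃ C[t]`. -/
noncomputable def tensorEquiv (k C : Type u) [Field k] [CommRing C] [Algebra k C] (n : ℕ) :
    (C ⊗[k] MvPolynomial (Fin n) k) ≃ₐ[k] MvPolynomial (Fin n) C :=
  (MvPolynomial.algebraTensorAlgEquiv (σ := Fin n) k C).restrictScalars k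

@[simp] lemma tensorEquiv_tmul (c : C) (t : MvPolynomial (Fin n) k) :
    tensorEquiv k C n (c ⊗ₜ t) = c • MvPolynomial.map (algebraMap k C) t := by
  simp [tensorEquiv]

/-- `k[x] ⊗ k[t] ≃ k[x, t]`. -/
noncomputable def polynomialTensorEquiv (k : Type u) [Field k] (n : ℕ) :
    (Polynomial k ⊗[k] MvPolynomial (Fin n) k) ≃ₐ[k] MvPolynomial (Option (Fin n)) k :=
  ((Algebra.TensorProduct.comm k _ _).trans (polyEquivTensor k _).symm).trans
    ((MvPolynomial.optionEquivLeft k (Fin n)).symm.restrictScalars k)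

lemma polynomialTensorEquiv_X :
    polynomialTensorEquiv k n (Polynomial.X ⊗ₜ 1) = MvPolynomial.X none := by
  rw [polynomialTensorEquiv, AlgEquiv.trans_apply]
  have : (polyEquivTensor k (MvPolynomial (Fin n) k)).symm (1 ⊗ₜ Polynomial.X) = Polynomial.X := by
    rw [AlgEquiv.symm_apply_eq, polyEquivTensor_apply]
    simp
  simp [this]

theorem stronglyCancellative_of_center_eq_bot [Nontrivial A]
    (hA : Subalgebra.center k A = ⊥) : StronglyCancellative k A := by
  rintro n - B _ _ ⟨σ⟩
  have hdr : (Algebra.ofId k A).range = Subalgebra.center k A := hA.symm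
  obtain ⟨τ, hτ⟩ := exists_center_equiv (Algebra.ofId k A).injective hdr
    (c := (Subalgebra.center k B).val) Subtype.val_injective (Subalgebra.range_val _) σ
  have hb := algebraMap_bijective_of_equiv
    (((Algebra.TensorProduct.lid k _).symm.trans τ).trans (tensorEquiv k _ n))
  refine nonempty_algEquiv_of_center (MvPolynomial.aeval fun _ => 0) hdr _ σ τ hτ
    (AlgEquiv.ofBijective (Algebra.ofId k _) hb) fun x => ?_
  have h := τ.commutes x
  rw [Algebra.TensorProduct.algebraMap_apply, Algebra.TensorProduct.algebraMap_apply] at h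
  exact h

/-- The case where the centre is `k[z]` and `z` is detected by characters. -/
theorem stronglyCancellative_of_character [Infinite k] (d : Polynomial k →ₐ[k] A)
    (hd : Function.Injective d) (hdr : d.range = Subalgebra.center k A) (ε : A →ₐ[k] k)
    (hε : ∀ χ : A →ₐ[k] k, χ (d Polynomial.X) = 0) : StronglyCancellative k A := by
  rintro n - B _ _ ⟨σ⟩
  let c := (Subalgebra.center k B).val
  obtain ⟨τ, hτ⟩ := exists_center_equiv hd hdr
    (c := c) Subtype.val_injective (Subalgebra.range_val _) σ
  let χ : B →ₐ[k] k := ε.comp ((specialize A (MvPolynomial.aeval fun _ => 0)).comp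
    (σ.symm.toAlgHom.comp includeLeft))
  let β := ((polynomialTensorEquiv k n).symm.trans τ).trans (tensorEquiv k _ n)
  have hβ : β (MvPolynomial.X none) = tensorEquiv k _ n (τ (Polynomial.X ⊗ₜ 1)) := by
    simp only [β, AlgEquiv.trans_apply, ← polynomialTensorEquiv_X, AlgEquiv.symm_apply_apply]
  have hspec : ∀ (v : Fin n → k) (w : Subalgebra.center k B ⊗[k] MvPolynomial (Fin n) k),
      MvPolynomial.eval v (MvPolynomial.map (χ.comp c).toRingHom (tensorEquiv k _ n w)) =
        χ (specialize B (MvPolynomial.aeval v) (map c (AlgHom.id k _) w)) := by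
    intro v w
    induction w with
    | zero => simp
    | add x y hx hy => simp only [map_add, hx, hy]
    | tmul x t =>
      simp [MvPolynomial.smul_eq_C_mul, MvPolynomial.map_map, MvPolynomial.aeval_eq_eval, mul_comm]
  obtain ⟨z, hz, hbij⟩ := exists_C_eq_of_map_eq_zero β (χ.comp c) (by
    apply MvPolynomial.funext
    intro v
    rw [hβ, hspec, ← hτ, map_zero]
    have := hε (χ.comp ((specialize B (MvPolynomial.aeval v)).comp (σ.toAlgHom.comp includeLeft)))
    simpa using this)
  refine nonempty_algEquiv_of_center (MvPolynomial.aeval fun _ => 0) hdr _ σ τ hτ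
    (AlgEquiv.ofBijective _ hbij) fun x => ?_
  have : τ.toAlgHom.comp includeLeft = (includeLeft).comp (Polynomial.aeval z) := by
    ext
    apply (tensorEquiv k _ n).injective
    have := hβ.symm.trans hz
    simpa [MvPolynomial.smul_eq_C_mul] using this
  exact DFunLike.congr_fun this x

/-- The case where the centre is `k[z]` and `z` is a direct polynomial variable of `A`. -/
theorem stronglyCancellative_of_lift [IsAlgClosed k] (d : Polynomial k →ₐ[k] A)
    (hd : Function.Injective d) (hdr : d.range = Subalgebra.center k A) (G : Set A)
    (hG : Algebra.adjoin k (insert (d Polynomial.X) G) = ⊤)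
    (hlift : ∀ (S : Type u) [Ring S] [Algebra k S] (f : A →ₐ[k] S) (y : S),
      (∀ a, Commute y (f a)) → ∃ f' : A →ₐ[k] S, f' (d Polynomial.X) = y ∧ ∀ a ∈ G, f' a = f a) :
    StronglyCancellative k A := by
  rintro n - B _ _ ⟨σ⟩
  let T := MvPolynomial (Fin n) k
  let c := (Subalgebra.center k B).val
  obtain ⟨τ, hτ⟩ := exists_center_equiv hd hdr
    (c := c) Subtype.val_injective (Subalgebra.range_val _) σ
  obtain ⟨δ⟩ := nonempty_polynomial_equiv
    (((polynomialTensorEquiv k n).symm.trans τ).trans (tensorEquiv k _ n))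
  let dT := map d (AlgHom.id k T)
  have comm : ∀ (x : Polynomial k ⊗[k] T) (a : A ⊗[k] T), Commute (dT x) a := fun x a =>
    commute_of_range_eq_center (range_map_id_eq_center hdr) x a
  have hex (τ : (Polynomial k ⊗[k] T) →ₐ[k] (Polynomial k ⊗[k] T)) :
      ∃ f : A →ₐ[k] A ⊗[k] T, f (d Polynomial.X) = dT (τ (Polynomial.X ⊗ₜ 1)) ∧
        ∀ a ∈ G, f a = a ⊗ₜ 1 :=
    hlift _ includeLeft _ (fun a => comm _ _)
  choose f hfX hfG using hex
  let L (τ : (Polynomial k ⊗[k] T) →ₐ[k] (Polynomial k ⊗[k] T)) : A ⊗[k] T →ₐ[k] A ⊗[k] T :=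
    Algebra.TensorProduct.lift (f τ) (dT.comp (τ.comp includeRight)) fun a t => (comm _ _).symm
  have hl (τ) (a : A) : L τ (a ⊗ₜ 1) = f τ a :=
    (lift_tmul _ _ _ _ _).trans (by simp [← one_def])
  have hr (τ) (t : T) : L τ (1 ⊗ₜ t) = dT (τ (1 ⊗ₜ t)) :=
    (lift_tmul _ _ _ _ _).trans (by simp)
  have hL (τ) (x) : L τ (dT x) = dT (τ x) := by
    have : (L τ).comp dT = dT.comp τ := by
      ext x
      · simp [dT, hl, hfX]
      · simp [dT, hr]
    exact DFunLike.congr_fun this x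
  have inv : ∀ τ τ' : (Polynomial k ⊗[k] T) →ₐ[k] (Polynomial k ⊗[k] T),
      τ.comp τ' = AlgHom.id k _ → (L τ).comp (L τ') = AlgHom.id k _ := by
    intro τ τ' h
    have h' : ∀ x, τ (τ' x) = x := fun x => DFunLike.congr_fun h x
    apply Algebra.TensorProduct.ext
    · apply AlgHom.ext_of_adjoin_eq_top hG
      rintro a (rfl | ha)
      · simp [hl, hfX, hL, h', dT]
      · simp [hl, hfG _ _ ha]
    · ext x
      simp [hr, hL, h', dT]
  let τ' := τ.trans (Algebra.TensorProduct.congr δ.symm (AlgEquiv.refl (A₁ := T)))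
  exact nonempty_algEquiv_of_extension (MvPolynomial.aeval fun _ => 0) d c σ τ hτ δ
    (AlgEquiv.ofAlgHom (L τ') (L τ'.symm) (inv _ _ (by ext x <;> simp))
      (inv _ _ (by ext x <;> simp))) (hL τ')

end Criteria

section Enveloping

open UniversalEnvelopingAlgebra
open scoped IsMulCommutative

attribute [local instance] LieRing.ofAssociativeRing

variable {k : Type*} [Field k] {A : Type*} [Ring A] [Algebra k A]

lemma mul_mem_of_adjoin_eq_top {G : Set A} (hG : Algebra.adjoin k G = ⊤) (M : Submodule k A)
    (hM : ∀ a ∈ G, ∀ m ∈ M, a * m ∈ M) (a m : A) (hm : m ∈ M) : a * m ∈ M := by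
  have ha : a ∈ Algebra.adjoin k G := hG ▸ Algebra.mem_top
  induction ha using Algebra.adjoin_induction generalizing m with
  | mem a h => exact hM a h m hm
  | algebraMap r => rw [← Algebra.smul_def]; exact M.smul_mem r hm
  | add a b _ _ ha hb => rw [add_mul]; exact M.add_mem (ha m hm) (hb m hm)
  | mul a b _ _ ha hb => rw [mul_assoc]; exact ha _ (hb m hm)

lemma mem_center_of_adjoin_eq_top {G : Set A} (hG : Algebra.adjoin k G = ⊤) {z : A}
    (hz : ∀ a ∈ G, a * z = z * a) : z ∈ Subalgebra.center k A := by
  rw [Subalgebra.mem_center_iff]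
  intro a
  have ha : a ∈ Algebra.adjoin k G := hG ▸ Algebra.mem_top
  induction ha using Algebra.adjoin_induction with
  | mem a h => exact hz a h
  | algebraMap r => exact Algebra.commutes r z
  | add a b _ _ ha hb => rw [add_mul, mul_add, ha, hb]
  | mul a b _ _ ha hb => rw [mul_assoc, hb, ← mul_assoc, ha, mul_assoc]

/-- Two commuting elements define a homomorphism from the polynomial ring in two variables. -/
lemma exists_algHom_of_commute {x y : A} (h : x * y = y * x) :
    ∃ F : MvPolynomial (Fin 2) k →ₐ[k] A, F (MvPolynomial.X 0) = x ∧ F (MvPolynomial.X 1) = y := by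
  have hc : ∀ a ∈ ({x, y} : Set A), ∀ b ∈ ({x, y} : Set A), a * b = b * a := by
    rintro a (rfl | rfl) b (rfl | rfl) <;> simp [h]
  have := Algebra.isMulCommutative_adjoin k hc
  let v : Fin 2 → Algebra.adjoin k ({x, y} : Set A) :=
    ![⟨x, Algebra.subset_adjoin (by simp)⟩, ⟨y, Algebra.subset_adjoin (by simp)⟩]
  exact ⟨(Algebra.adjoin k ({x, y} : Set A)).val.comp (MvPolynomial.aeval v), by simp [v],
    by simp [v]⟩

variable {g : Type*} [LieRing g] [LieAlgebra k g] (b : Module.Basis (Fin 3) k g)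

lemma ι_lie (x y : g) : ι k ⁅x, y⁆ = ι k x * ι k y - ι k y * ι k x := by
  rw [LieHom.map_lie, LieRing.of_associative_ring_bracket]

lemma adjoin_range_ι_basis : Algebra.adjoin k (Set.range fun i => ι k (b i)) = ⊤ := by
  set S := Algebra.adjoin k (Set.range fun i => ι k (b i)) with hS
  have h (x : g) : ι k x ∈ S := by
    rw [← b.sum_repr x, map_sum]
    refine Subalgebra.sum_mem _ fun i _ => ?_
    rw [map_smul]
    exact Subalgebra.smul_mem _ (Algebra.subset_adjoin (Set.mem_range_self i)) _
  let f : g →ₗ⁅k⁆ S :=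
    { (ι k : g →ₗ⁅k⁆ UniversalEnvelopingAlgebra k g).toLinearMap.codRestrict
        (Subalgebra.toSubmodule S) h with
      map_lie' := fun {x y} => Subtype.ext (ι_lie x y) }
  have hf : S.val.comp (lift k f) = AlgHom.id k _ := by
    ext x
    change S.val (lift k f (ι k x)) = ι k x
    rw [lift_ι_apply]
    rfl
  refine eq_top_iff.mpr fun a _ => ?_
  rw [show a = S.val (lift k f a) from (DFunLike.congr_fun hf a).symm]
  exact (lift k f a).2

lemma exists_lift_of_basis {S : Type*} [Ring S] [Algebra k S] (s : Fin 3 → S)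
    (h01 : s 0 * s 1 - s 1 * s 0 = b.constr k s ⁅b 0, b 1⁆)
    (h02 : s 0 * s 2 - s 2 * s 0 = b.constr k s ⁅b 0, b 2⁆)
    (h12 : s 1 * s 2 - s 2 * s 1 = b.constr k s ⁅b 1, b 2⁆) :
    ∃ F : UniversalEnvelopingAlgebra k g →ₐ[k] S, ∀ i, F (ι k (b i)) = s i := by
  have key : ∀ i j, b.constr k s ⁅b i, b j⁆ = s i * s j - s j * s i := by
    intro i j
    have hneg (i j) (h : s i * s j - s j * s i = b.constr k s ⁅b i, b j⁆) :
        b.constr k s ⁅b j, b i⁆ = s j * s i - s i * s j := by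
      rw [← lie_skew, map_neg, ← h, neg_sub]
    fin_cases i <;> fin_cases j
    all_goals first
      | exact Eq.symm h01 | exact Eq.symm h02 | exact Eq.symm h12
      | exact hneg _ _ h01 | exact hneg _ _ h02 | exact hneg _ _ h12
      | simp
  let f : g →ₗ⁅k⁆ S :=
    { b.constr k s with
      map_lie' := fun {x y} => by
        change b.constr k s ⁅x, y⁆ = ⁅b.constr k s x, b.constr k s y⁆
        rw [LieRing.of_associative_ring_bracket]
        have h1 (i : Fin 3) (y : g) : b.constr k s ⁅b i, y⁆ =
            s i * b.constr k s y - b.constr k s y * s i := by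
          conv_lhs => rw [← b.sum_repr y]
          conv_rhs => rw [← b.sum_repr y]
          simp only [lie_sum, lie_smul, map_sum, map_smul, key, Module.Basis.constr_basis,
            Finset.mul_sum, Finset.sum_mul, mul_smul_comm, smul_mul_assoc, smul_sub,
            Finset.sum_sub_distrib]
        conv_lhs => rw [← b.sum_repr x]
        conv_rhs => rw [← b.sum_repr x]
        simp only [sum_lie, smul_lie, map_sum, map_smul, h1, Module.Basis.constr_basis,
          Finset.mul_sum, Finset.sum_mul, mul_smul_comm, smul_mul_assoc, smul_sub,
          Finset.sum_sub_distrib] }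
  refine ⟨lift k f, fun i => ?_⟩
  rw [lift_ι_apply]
  exact b.constr_basis k s i

lemma ι_basis_mul {S : Type*} [Ring S] [Algebra k S]
    (f : UniversalEnvelopingAlgebra k g →ₐ[k] S) (i j : Fin 3) :
    f (ι k (b i)) * f (ι k (b j)) - f (ι k (b j)) * f (ι k (b i)) =
      b.constr k (fun l => f (ι k (b l))) ⁅b i, b j⁆ := by
  have : b.constr k (fun l => f (ι k (b l))) = f.toLinearMap ∘ₗ (ι k : g →ₗ⁅k⁆ _).toLinearMap :=
    b.ext fun l => by simp [-ι_apply]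
  rw [this, ← map_mul f, ← map_mul f, ← map_sub, ← ι_lie]
  rfl

lemma algHom_ι_lie {S : Type*} [CommRing S] [Algebra k S]
    (χ : UniversalEnvelopingAlgebra k g →ₐ[k] S) (x y : g) : χ (ι k ⁅x, y⁆) = 0 := by
  rw [ι_lie, map_sub, map_mul, map_mul, mul_comm, sub_self]

variable (k g) in
/-- The augmentation of the enveloping algebra. -/
noncomputable def augmentation : UniversalEnvelopingAlgebra k g →ₐ[k] k := lift k 0

end Enveloping

section Ore

open UniversalEnvelopingAlgebra

variable {k : Type*} [Field k]

section Sequences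

variable {P : Type*} [CommRing P] [Algebra k P] (δ : Derivation k P P)

/-- The operator `t + δ` on `P⟦t⟧`, a power series being given by its sequence of coefficients. -/
def shiftAdd : (ℕ → P) →ₗ[k] (ℕ → P) where
  toFun φ i := (if i = 0 then 0 else φ (i - 1)) + δ (φ i)
  map_add' φ ψ := by
    ext i
    by_cases h : i = 0
    · simp [h]
    · simp [h]; abel
  map_smul' r φ := by
    ext i
    by_cases h : i = 0 <;> simp [h]

lemma shiftAdd_apply_zero (φ : ℕ → P) : shiftAdd δ φ 0 = δ (φ 0) := by simp [shiftAdd]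

lemma shiftAdd_apply_succ (φ : ℕ → P) (i : ℕ) :
    shiftAdd δ φ (i + 1) = φ i + δ (φ (i + 1)) := by simp [shiftAdd]

lemma shiftAdd_smul (p : P) (φ : ℕ → P) :
    shiftAdd δ (p • φ) = p • shiftAdd δ φ + δ p • φ := by
  ext i
  cases i with
  | zero => simp [shiftAdd_apply_zero, mul_comm]
  | succ i => simp [shiftAdd_apply_succ, mul_comm, mul_add, add_assoc]

lemma shiftAdd_pow_one (i : ℕ) : (shiftAdd δ ^ i) (Pi.single 0 1) = Pi.single i 1 := by
  induction i with
  | zero => simp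
  | succ i ih =>
    rw [pow_succ', Module.End.mul_apply, ih]
    have h (b : ℕ) : δ ((Pi.single i 1 : ℕ → P) b) = 0 := by
      rw [Pi.single_apply]; split_ifs <;> simp
    ext j
    cases j with
    | zero => rw [shiftAdd_apply_zero, h]; simp
    | succ j => rw [shiftAdd_apply_succ, h]; simp [Pi.single_apply]

lemma shiftAdd_pow_apply_of_lt (x : P) {i j : ℕ} (h : i < j) :
    (shiftAdd δ ^ i) (Pi.single 0 x) j = 0 := by
  induction i generalizing j with
  | zero => simp [h.ne']
  | succ i ih =>
    obtain ⟨j, rfl⟩ := Nat.exists_eq_add_of_lt h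
    rw [pow_succ', Module.End.mul_apply, shiftAdd_apply_succ, ih (by omega), ih (by omega)]
    simp

lemma shiftAdd_pow_apply_self (x : P) (i : ℕ) : (shiftAdd δ ^ i) (Pi.single 0 x) i = x := by
  induction i with
  | zero => simp
  | succ i ih =>
    rw [pow_succ', Module.End.mul_apply, shiftAdd_apply_succ, ih,
      shiftAdd_pow_apply_of_lt δ x (by omega)]
    simp

lemma shiftAdd_pow_succ_apply (x : P) (i : ℕ) :
    (shiftAdd δ ^ (i + 1)) (Pi.single 0 x) i = (i + 1) * δ x := by
  induction i with
  | zero => simp [shiftAdd_apply_zero]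
  | succ i ih =>
    rw [pow_succ', Module.End.mul_apply, shiftAdd_apply_succ, ih,
      shiftAdd_pow_apply_self]
    push_cast
    ring

end Sequences

section Centre

variable {P A : Type*} [CommRing P] [IsDomain P] [CharZero P] [Algebra k P] [Ring A] [Algebra k A]

/-- The centre of the Ore extension `P[e; δ]` with `δ ≠ 0` is the kernel of `δ`. -/
lemma ore_center {δ : Derivation k P P} (hδ : ∃ x, δ x ≠ 0) (J : P →ₐ[k] A) {e : A}
    (he : ∀ p, e * J p = J p * e + J (δ p))
    (hgen : Algebra.adjoin k (insert e (J.range : Set A)) = ⊤)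
    (Φ : A →ₐ[k] Module.End k (ℕ → P)) (hΦe : Φ e = shiftAdd δ)
    (hΦJ : ∀ p φ, Φ (J p) φ = p • φ) :
    Function.Injective J ∧ ∀ z, z ∈ Subalgebra.center k A ↔ ∃ p, δ p = 0 ∧ J p = z := by
  refine ⟨fun p q h => ?_, fun z => ⟨fun hz => ?_, ?_⟩⟩
  · have := congrFun (congrArg (fun a => Φ a (Pi.single 0 1)) h) 0
    simpa [hΦJ] using this
  · have hspan : Submodule.span k {a | ∃ p i, a = J p * e ^ i} = ⊤ := by
      have key := mul_mem_of_adjoin_eq_top hgen (Submodule.span k {a | ∃ p i, a = J p * e ^ i}) (by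
        intro a ha m hm
        refine Submodule.span_induction (p := fun m _ => a * m ∈ _) ?_ (by simp)
          (fun x y _ _ hx hy => by rw [mul_add]; exact Submodule.add_mem _ hx hy)
          (fun r x _ hx => by rw [mul_smul_comm]; exact Submodule.smul_mem _ r hx) hm
        rintro _ ⟨p, i, rfl⟩
        rcases ha with rfl | ⟨q, rfl⟩
        · rw [← mul_assoc, he, add_mul, mul_assoc, ← pow_succ']
          exact Submodule.add_mem _ (Submodule.subset_span ⟨_, _, rfl⟩)
            (Submodule.subset_span ⟨_, _, rfl⟩)
        · exact Submodule.subset_span ⟨q * p, i, by simp [mul_assoc]⟩)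
      refine eq_top_iff.mpr fun a _ => ?_
      simpa using key a 1 (Submodule.subset_span ⟨1, 0, by simp⟩)
    obtain ⟨f, rfl⟩ : ∃ f : Polynomial P, f.sum (fun i p => J p * e ^ i) = z := by
      have hz : z ∈ Submodule.span k {a | ∃ p i, a = J p * e ^ i} := hspan ▸ Submodule.mem_top
      clear * - hz
      induction hz using Submodule.span_induction with
      | mem x h =>
        obtain ⟨p, i, rfl⟩ := h
        exact ⟨Polynomial.monomial i p, Polynomial.sum_monomial_index p _ (by simp)⟩
      | zero => exact ⟨0, by simp⟩
      | add x y _ _ hx hy =>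
        obtain ⟨f, rfl⟩ := hx
        obtain ⟨g, rfl⟩ := hy
        exact ⟨f + g, Polynomial.sum_add_index f g _ (by simp) (by simp [add_mul])⟩
      | smul r x _ hx =>
        obtain ⟨f, rfl⟩ := hx
        refine ⟨r • f, ?_⟩
        rw [Polynomial.sum_over_range' _ (by simp) _
            (lt_of_le_of_lt (Polynomial.natDegree_smul_le r f) (Nat.lt_succ_self _)),
          Polynomial.sum_over_range _ (by simp), Finset.smul_sum]
        simp
    have hact (φ : ℕ → P) : Φ (f.sum (fun i p => J p * e ^ i)) φ =
        f.sum fun i p => p • (shiftAdd δ ^ i) φ := by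
      simp [Polynomial.sum_def, hΦJ, hΦe]
    have hcomm := fun a => Subalgebra.mem_center_iff.mp hz a
    have hf : f.natDegree = 0 := by
      obtain ⟨x, hx⟩ := hδ
      by_contra hm
      obtain ⟨m, hm⟩ := Nat.exists_eq_succ_of_ne_zero hm
      have h := congrFun (congrArg (fun a => Φ a (Pi.single 0 1)) (hcomm (J x))) m
      have hx1 : x • (Pi.single 0 1 : ℕ → P) = Pi.single 0 x := by
        rw [← Pi.single_smul]; simp
      simp only [map_mul, Module.End.mul_apply, hΦJ, hact, hx1] at h
      rw [Polynomial.sum_over_range _ (by simp), Polynomial.sum_over_range _ (by simp), hm,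
        Finset.sum_range_succ, Finset.sum_range_succ, Finset.sum_range_succ _ (m + 1),
        Finset.sum_range_succ _ m] at h
      simp only [shiftAdd_pow_one, Pi.smul_apply, Pi.add_apply, Finset.sum_apply,
        shiftAdd_pow_apply_self, shiftAdd_pow_succ_apply] at h
      rw [Finset.sum_eq_zero, Finset.sum_eq_zero] at h
      · have h2 : f.coeff (m + 1) ≠ 0 := by
          rw [← Nat.succ_eq_add_one, ← hm, Polynomial.coeff_natDegree,
            Polynomial.leadingCoeff_ne_zero]
          rintro rfl
          simp at hm
        have : f.coeff (m + 1) * ((m + 1) * δ x) = 0 := by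
          have h' := h
          simp at h'
          linear_combination -h'
        have h3 : (m + 1 : P) ≠ 0 := by exact_mod_cast Nat.succ_ne_zero m
        simp_all
      · intro i hi
        rw [shiftAdd_pow_apply_of_lt _ _ (Finset.mem_range.mp hi)]; simp
      · intro i hi
        have := (Finset.mem_range.mp hi).ne'
        simp [this]
    obtain ⟨p, rfl⟩ := Polynomial.natDegree_eq_zero.mp hf
    have hp : (Polynomial.C p).sum (fun i p => J p * e ^ i) = J p := by
      rw [Polynomial.sum_C_index] <;> simp
    refine ⟨p, ?_, hp.symm⟩
    rw [hp] at hcomm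
    have h := hcomm e
    rw [he, add_eq_left] at h
    have := congrFun (congrArg (fun a => Φ a (Pi.single 0 1)) h) 0
    simpa [hΦJ] using this
  · rintro ⟨p, hp, rfl⟩
    refine mem_center_of_adjoin_eq_top hgen ?_
    rintro a (rfl | ⟨q, rfl⟩)
    · rw [he, hp]; simp
    · change J q * J p = _; rw [← map_mul, mul_comm, map_mul]; rfl

end Centre

end Ore

section Semidirect

open UniversalEnvelopingAlgebra MvPolynomial

variable {k : Type*} [Field k]

/-- The derivation `x ↦ a x`, `y ↦ b y + c x` of `k[x, y]`. -/
noncomputable def triangularDerivation (a b c : k) :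
    Derivation k (MvPolynomial (Fin 2) k) (MvPolynomial (Fin 2) k) :=
  (C a * X 0 : MvPolynomial (Fin 2) k) • pderiv 0 +
    (C b * X 1 + C c * X 0 : MvPolynomial (Fin 2) k) • pderiv 1

variable (a b c : k)

lemma triangularDerivation_X_zero : triangularDerivation a b c (X 0) = a • X 0 := by
  simp [triangularDerivation, smul_eq_C_mul, pderiv_X_of_ne (show (0 : Fin 2) ≠ 1 by decide)]

lemma triangularDerivation_X_one : triangularDerivation a b c (X 1) = b • X 1 + c • X 0 := by
  simp [triangularDerivation, smul_eq_C_mul, pderiv_X_of_ne (show (1 : Fin 2) ≠ 0 by decide)]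

lemma coeff_X_mul_pderiv (i : Fin 2) (m : Fin 2 →₀ ℕ) (p : MvPolynomial (Fin 2) k) :
    coeff m (X i * pderiv i p) = m i * coeff m p := by
  rw [coeff_X_mul']
  split_ifs with h
  · have hle : Finsupp.single i 1 ≤ m := by
      rw [Finsupp.single_le_iff]
      exact Nat.one_le_iff_ne_zero.mpr (Finsupp.mem_support_iff.mp h)
    have h1 : m i ≠ 0 := Finsupp.mem_support_iff.mp h
    rw [coeff_pderiv, tsub_add_cancel_of_le hle, mul_comm]
    congr 1
    have : ((m i - 1 : ℕ) : k) + 1 = m i := by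
      exact_mod_cast congrArg (Nat.cast (R := k))
        (Nat.sub_add_cancel (Nat.one_le_iff_ne_zero.mpr h1))
    simpa using this
  · simp [Finsupp.notMem_support_iff.mp h]

lemma coeff_triangularDerivation (m : Fin 2 →₀ ℕ) (p : MvPolynomial (Fin 2) k) :
    coeff m (triangularDerivation a b c p) = (a * m 0 + b * m 1) * coeff m p +
      c * coeff m (X 0 * pderiv 1 p) := by
  have : triangularDerivation a b c p =
      C a * (X 0 * pderiv 0 p) + C b * (X 1 * pderiv 1 p) + C c * (X 0 * pderiv 1 p) := by
    simp [triangularDerivation]; ring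
  rw [this, coeff_add, coeff_add, coeff_C_mul, coeff_C_mul, coeff_C_mul, coeff_X_mul_pderiv,
    coeff_X_mul_pderiv]
  ring

/-- The kernel of a diagonal derivation when the solutions of `a i + b j = 0` are generated by a
single one. -/
lemma triangularDerivation_diag_eq_zero {m₀ : Fin 2 →₀ ℕ}
    (h : ∀ m : Fin 2 →₀ ℕ, a * m 0 + b * m 1 = 0 ↔ ∃ t : ℕ, m = t • m₀)
    (p : MvPolynomial (Fin 2) k) : triangularDerivation a b 0 p = 0 ↔
      ∃ f : Polynomial k, Polynomial.aeval (monomial m₀ (1 : k)) f = p := by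
  constructor
  · intro hp
    have hm : ∀ m ∈ p.support, ∃ t : ℕ, m = t • m₀ := by
      intro m hm
      rw [← h]
      have := congrArg (coeff m) hp
      rw [coeff_triangularDerivation] at this
      simpa [mem_support_iff.mp hm] using this
    choose! t ht using hm
    refine ⟨∑ m ∈ p.support, Polynomial.C (coeff m p) * Polynomial.X ^ t m, ?_⟩
    conv_rhs => rw [p.as_sum]
    rw [map_sum]
    refine Finset.sum_congr rfl fun m hm => ?_
    conv_rhs => rw [ht m hm]
    simp [monomial_pow, ← ht m hm, algebraMap_eq, C_mul_monomial]
  · rintro ⟨f, rfl⟩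
    have h0 : triangularDerivation a b 0 (monomial m₀ (1 : k)) = 0 := by
      ext m
      rw [coeff_triangularDerivation, coeff_monomial]
      split_ifs with hm
      · rw [← hm, (h m₀).mpr ⟨1, by simp⟩]; simp
      · simp
    induction f using Polynomial.induction_on' with
    | add f g hf hg => rw [map_add, map_add, hf, hg, add_zero]
    | monomial n r =>
      rw [Polynomial.aeval_monomial, Derivation.leibniz, Derivation.leibniz_pow, h0]
      simp

/-- The kernel of `x ↦ 0`, `y ↦ c x`. -/
lemma triangularDerivation_nilpotent_eq_zero [CharZero k] {c : k} (hc : c ≠ 0)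
    (p : MvPolynomial (Fin 2) k) : triangularDerivation 0 0 c p = 0 ↔
      ∃ f : Polynomial k, Polynomial.aeval (X 0 : MvPolynomial (Fin 2) k) f = p := by
  rw [← show triangularDerivation 0 1 0 p = 0 ↔
      ∃ f : Polynomial k, Polynomial.aeval (X 0 : MvPolynomial (Fin 2) k) f = p from
    triangularDerivation_diag_eq_zero 0 1 (m₀ := Finsupp.single 0 1) (fun m => ?_) p]
  · simp [triangularDerivation, hc, X_ne_zero]
  · simp only [zero_mul, one_mul, zero_add, Nat.cast_eq_zero]
    refine ⟨fun h => ⟨m 0, ?_⟩, ?_⟩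
    · ext i; fin_cases i <;> simp [h]
    · rintro ⟨t, rfl⟩; simp

/-- The kernel of `x ↦ a x`, `y ↦ a y + c x` for `a ≠ 0`. -/
lemma triangularDerivation_jordan_eq_zero [CharZero k] {a : k} (ha : a ≠ 0) (c : k)
    {p : MvPolynomial (Fin 2) k} (hp : triangularDerivation a a c p = 0) : ∃ r, p = C r := by
  have key : ∀ i (m : Fin 2 →₀ ℕ), m 0 = i → m ≠ 0 → coeff m p = 0 := by
    intro i
    induction i with
    | zero =>
      intro m h0 hm
      have h := congrArg (coeff m) hp
      rw [coeff_triangularDerivation, coeff_X_mul'] at h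
      have h1 : (m 1 : k) ≠ 0 := by
        rw [Nat.cast_ne_zero]
        rintro h1
        exact hm (by ext i; fin_cases i <;> simp [h0, h1])
      simpa [h0, ha, h1] using h
    | succ i ih =>
      intro m h0 hm
      have h := congrArg (coeff m) hp
      have h2 : a * m 0 + a * m 1 ≠ 0 := by
        rw [← mul_add, h0]
        exact mul_ne_zero ha (by exact_mod_cast (by omega))
      have h3 : coeff (m - Finsupp.single 0 1 + Finsupp.single 1 1) p = 0 :=
        ih _ (by simp [h0]) fun h => by simpa using DFunLike.congr_fun h 1
      rw [coeff_triangularDerivation, coeff_X_mul', if_pos (by simp [h0]), coeff_pderiv, h3] at h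
      simpa [h2] using h
  refine ⟨coeff 0 p, ?_⟩
  ext m
  rw [coeff_C]
  split_ifs with h
  · rw [h]
  · exact key _ m rfl (Ne.symm h)

variable {a b c} {g : Type*} [LieRing g] [LieAlgebra k g] (B : Module.Basis (Fin 3) k g)

lemma semidirect_center [CharZero k] (h12 : ⁅B 1, B 2⁆ = 0) (h01 : ⁅B 0, B 1⁆ = a • B 1)
    (h02 : ⁅B 0, B 2⁆ = b • B 2 + c • B 1) (hne : a ≠ 0 ∨ b ≠ 0 ∨ c ≠ 0) :
    ∃ J : MvPolynomial (Fin 2) k →ₐ[k] UniversalEnvelopingAlgebra k g, Function.Injective J ∧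
      J (X 0) = ι k (B 1) ∧ J (X 1) = ι k (B 2) ∧
      ∀ z, z ∈ Subalgebra.center k (UniversalEnvelopingAlgebra k g) ↔
        ∃ p, triangularDerivation a b c p = 0 ∧ J p = z := by
  obtain ⟨J, hJ0, hJ1⟩ := exists_algHom_of_commute (k := k) (x := ι k (B 1)) (y := ι k (B 2)) (by
    rw [← sub_eq_zero, ← ι_lie, h12, map_zero])
  have he0 : ι k (B 0) * ι k (B 1) = ι k (B 1) * ι k (B 0) + a • ι k (B 1) := by
    rw [← map_smul, ← h01, ι_lie]; abel
  have he1 : ι k (B 0) * ι k (B 2) =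
      ι k (B 2) * ι k (B 0) + (b • ι k (B 2) + c • ι k (B 1)) := by
    rw [← map_smul (ι k), ← map_smul (ι k), ← map_add, ← h02, ι_lie]; abel
  set δ := triangularDerivation a b c with hδ
  have he (p) : ι k (B 0) * J p = J p * ι k (B 0) + J (δ p) := by
    induction p using MvPolynomial.induction_on with
    | C r =>
      have : J (C r) = algebraMap k _ r := J.commutes r
      have h2 : δ (C r) = 0 := δ.map_algebraMap r
      rw [this, h2, Algebra.commutes]; simp
    | add p q hp hq => simp only [map_add, mul_add, hp, hq, add_mul]; abel
    | mul_X p i hp =>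
      have hi : ι k (B 0) * J (X i) = J (X i) * ι k (B 0) + J (δ (X i)) := by
        fin_cases i
        · simpa [hδ, triangularDerivation_X_zero, hJ0] using he0
        · simpa [hδ, triangularDerivation_X_one, hJ0, hJ1] using he1
      rw [map_mul, ← mul_assoc, hp, add_mul, mul_assoc, hi, Derivation.leibniz, smul_eq_mul,
        smul_eq_mul, map_add, map_mul, map_mul, mul_add, ← mul_assoc, add_assoc, ← map_mul,
        ← map_mul, ← map_mul, ← map_mul, mul_comm (δ p)]
  have hgen : Algebra.adjoin k (insert (ι k (B 0)) (J.range : Set _)) = ⊤ := by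
    rw [eq_top_iff, ← adjoin_range_ι_basis B]
    apply Algebra.adjoin_mono
    rintro _ ⟨i, rfl⟩
    fin_cases i
    · exact Or.inl rfl
    · exact Or.inr ⟨_, hJ0⟩
    · exact Or.inr ⟨_, hJ1⟩
  let mul : MvPolynomial (Fin 2) k →ₐ[k] Module.End k (ℕ → MvPolynomial (Fin 2) k) :=
    Algebra.lsmul k k _
  have hmul (p φ) : mul p φ = p • φ := rfl
  have hshift (p) : shiftAdd δ * mul p - mul p * shiftAdd δ = mul (δ p) := by
    ext1 φ
    simp [hmul, shiftAdd_smul]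
  obtain ⟨Φ, hΦ⟩ := exists_lift_of_basis B ![shiftAdd δ, mul (X 0), mul (X 1)]
    (by
      rw [h01, map_smul, Module.Basis.constr_basis]
      exact (hshift (X 0)).trans (by rw [hδ, triangularDerivation_X_zero, map_smul]; rfl))
    (by
      rw [h02, map_add, map_smul, map_smul, Module.Basis.constr_basis, Module.Basis.constr_basis]
      exact (hshift (X 1)).trans (by
        rw [hδ, triangularDerivation_X_one, map_add, map_smul, map_smul]; rfl))
    (by
      rw [h12, map_zero]
      simp [← map_mul, mul_comm])
  have hΦJ : Φ.comp J = mul := by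
    ext i : 1
    fin_cases i
    · simpa [hJ0, -ι_apply] using hΦ 1
    · simpa [hJ1, -ι_apply] using hΦ 2
  obtain ⟨h1, h2⟩ := ore_center (δ := δ) (by
    by_contra! h
    have h0 := congrArg (coeff (Finsupp.single 0 1)) (h (X 0))
    have h1 := congrArg (coeff (Finsupp.single 0 1)) (h (X 1))
    have h2 := congrArg (coeff (Finsupp.single 1 1)) (h (X 1))
    rw [hδ, triangularDerivation_X_zero] at h0
    rw [hδ, triangularDerivation_X_one] at h1 h2
    simp [coeff_X, Finsupp.single_left_inj] at h0 h1 h2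
    simp_all) J he hgen Φ (hΦ 0) fun p φ => by
      rw [← hmul, ← hΦJ]; rfl
  exact ⟨J, h1, hJ0, hJ1, h2⟩

end Semidirect

section SemidirectCancellation

open UniversalEnvelopingAlgebra MvPolynomial

lemma aeval_monomial_injective {k σ : Type*} [Field k] [DecidableEq σ] {m₀ : σ →₀ ℕ}
    (hm₀ : m₀ ≠ 0) :
    Function.Injective (Polynomial.aeval (monomial m₀ (1 : k)) : Polynomial k →ₐ[k] _) := by
  have hinj : Function.Injective fun t : ℕ => t • m₀ := fun s t h => by
    obtain ⟨i, hi⟩ := Finsupp.ne_iff.mp hm₀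
    have := DFunLike.congr_fun h i
    simpa [show m₀ i ≠ 0 from hi] using this
  have hcoeff (f : Polynomial k) (t : ℕ) :
      coeff (t • m₀) (Polynomial.aeval (monomial m₀ (1 : k)) f) = f.coeff t := by
    induction f using Polynomial.induction_on' with
    | add f g hf hg => simp [hf, hg]
    | monomial n r =>
      rw [Polynomial.aeval_monomial, monomial_pow, one_pow, algebraMap_eq, C_mul_monomial, mul_one,
        coeff_monomial, Polynomial.coeff_monomial]
      simp only [hinj.eq_iff]
  intro f f' h
  ext t
  rw [← hcoeff, h, hcoeff]

variable {k : Type u} [Field k]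

lemma stronglyCancellative_of_ker_trivial {A : Type u} [Ring A] [Algebra k A]
    (J : MvPolynomial (Fin 2) k →ₐ[k] A) (hJ : Function.Injective J)
    (h : ∀ z ∈ Subalgebra.center k A, ∃ r, z = J (C r)) : StronglyCancellative k A := by
  have := hJ.nontrivial
  refine stronglyCancellative_of_center_eq_bot (eq_bot_iff.mpr fun z hz => ?_)
  obtain ⟨r, rfl⟩ := h z hz
  exact Algebra.mem_bot.mpr ⟨r, (J.commutes r).symm⟩

/-- The generator of the centre as a homomorphism from `k[X]`. -/
lemma exists_center_generator {A : Type u} [Ring A] [Algebra k A]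
    {J : MvPolynomial (Fin 2) k →ₐ[k] A} (hJ : Function.Injective J)
    {K : MvPolynomial (Fin 2) k → Prop}
    (hc : ∀ z, z ∈ Subalgebra.center k A ↔ ∃ p, K p ∧ J p = z) {m₀ : Fin 2 →₀ ℕ} (hm₀ : m₀ ≠ 0)
    (hK : ∀ p, K p ↔ ∃ f : Polynomial k, Polynomial.aeval (monomial m₀ (1 : k)) f = p) :
    ∃ d : Polynomial k →ₐ[k] A, Function.Injective d ∧ d.range = Subalgebra.center k A ∧
      d Polynomial.X = J (monomial m₀ 1) := by
  refine ⟨J.comp (Polynomial.aeval (monomial m₀ 1)), hJ.comp (aeval_monomial_injective hm₀), ?_,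
    by simp⟩
  ext z
  rw [hc]
  constructor
  · rintro ⟨f, rfl⟩; exact ⟨_, (hK _).mpr ⟨f, rfl⟩, rfl⟩
  · rintro ⟨p, hp, rfl⟩
    obtain ⟨f, rfl⟩ := (hK p).mp hp
    exact ⟨f, rfl⟩

/-- If `i b = -j a` has a nonzero solution then the solutions are generated by a single one. -/
lemma exists_generator [CharZero k] {a b : k} (ha : a ≠ 0) (hb : b ≠ 0)
    {m : Fin 2 →₀ ℕ} (hm : m ≠ 0)
    (hab : a * m 0 + b * m 1 = 0) : ∃ m₀ : Fin 2 →₀ ℕ, m₀ 0 ≠ 0 ∧ m₀ 1 ≠ 0 ∧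
      ∀ m : Fin 2 →₀ ℕ, a * m 0 + b * m 1 = 0 ↔ ∃ t : ℕ, m = t • m₀ := by
  have h0 : m 0 ≠ 0 := by
    rintro h
    have h1 : m 1 = 0 := by simpa [h, hb] using hab
    exact hm (by ext i; fin_cases i <;> simp [h, h1])
  have h1 : m 1 ≠ 0 := by
    rintro h
    exact h0 (by simpa [h, ha] using hab)
  obtain ⟨e, p, q, he, hpq, hp, hq⟩ := Nat.exists_coprime'
    (Nat.gcd_pos_of_pos_left (m 1) (Nat.pos_of_ne_zero h0))
  have hp0 : p ≠ 0 := by rintro rfl; simp_all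
  have hq0 : q ≠ 0 := by rintro rfl; simp_all
  have he' : (e : k) ≠ 0 := by exact_mod_cast he.ne'
  have habpq : a * p + b * q = 0 := by
    rw [hp, hq] at hab
    push_cast at hab
    apply mul_right_cancel₀ he'
    linear_combination hab
  let m₀ : Fin 2 →₀ ℕ := Finsupp.equivFunOnFinite.symm ![p, q]
  have e0 : m₀ 0 = p := rfl
  have e1 : m₀ 1 = q := rfl
  refine ⟨m₀, by rwa [e0], by rwa [e1], fun n => ⟨fun hn => ?_, ?_⟩⟩
  · have h : n 0 * q = n 1 * p := by
      have : a * ((n 0 * q : ℕ) : k) = a * ((n 1 * p : ℕ) : k) := by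
        push_cast
        linear_combination (q : k) * hn - (n 1 : k) * habpq
      exact_mod_cast mul_left_cancel₀ ha this
    obtain ⟨t, ht⟩ : p ∣ n 0 := hpq.dvd_of_dvd_mul_right ⟨n 1, by rw [h, mul_comm]⟩
    refine ⟨t, ?_⟩
    ext i
    fin_cases i
    · simp [e0, ht, mul_comm]
    · rw [ht] at h
      have : n 1 = t * q := mul_right_cancel₀ hp0 (by rw [← h]; ring)
      simpa [e1] using this
  · rintro ⟨t, rfl⟩
    simp only [Finsupp.smul_apply, e0, e1, smul_eq_mul]
    push_cast
    linear_combination (t : k) * habpq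

variable [CharZero k] {g : Type u} [LieRing g] [LieAlgebra k g] (B : Module.Basis (Fin 3) k g)
  {a b c : k}

lemma stronglyCancellative_of_central [IsAlgClosed k] (h12 : ⁅B 1, B 2⁆ = 0) (h01 : ⁅B 0, B 1⁆ = 0)
    (h02 : ⁅B 0, B 2⁆ = b • B 2) (hb : b ≠ 0) :
    StronglyCancellative k (UniversalEnvelopingAlgebra k g) := by
  obtain ⟨J, hJ, hJ0, hJ1, hc⟩ := semidirect_center (a := 0) (b := b) (c := 0) B h12
    (by simp [h01]) (by simp [h02]) (by simp [hb])
  obtain ⟨d, hd, hdr, hdX⟩ := exists_center_generator hJ hc (m₀ := Finsupp.single 0 1) (by simp)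
    (triangularDerivation_diag_eq_zero 0 b fun m => by
      simp only [zero_mul, zero_add, mul_eq_zero, hb, Nat.cast_eq_zero, false_or]
      refine ⟨fun h => ⟨m 0, ?_⟩, ?_⟩
      · ext i; fin_cases i <;> simp [h]
      · rintro ⟨t, rfl⟩; simp)
  replace hdX : d Polynomial.X = ι k (B 1) := hdX.trans hJ0
  refine stronglyCancellative_of_lift d hd hdr {ι k (B 0), ι k (B 2)} ?_ ?_
  · rw [← adjoin_range_ι_basis B, hdX]
    congr 1
    ext x
    simp [Fin.exists_fin_succ, -ι_apply, eq_comm]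
    tauto
  · intro S _ _ f y hy
    obtain ⟨f', hf'⟩ := exists_lift_of_basis B ![f (ι k (B 0)), y, f (ι k (B 2))]
      (by simpa [h01, sub_eq_zero, -ι_apply] using (hy (ι k (B 0))).eq.symm)
      (by
        have := ι_basis_mul B f 0 2
        rw [h02, map_smul, Module.Basis.constr_basis] at this
        rw [h02, map_smul, Module.Basis.constr_basis]
        exact this)
      (by simpa [h12, sub_eq_zero, -ι_apply] using (hy (ι k (B 2))).eq)
    refine ⟨f', by rw [hdX]; exact hf' 1, ?_⟩
    rintro _ (rfl | rfl)
    · exact hf' 0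
    · exact hf' 2

theorem stronglyCancellative_of_diagonal [IsAlgClosed k] (h12 : ⁅B 1, B 2⁆ = 0)
    (h01 : ⁅B 0, B 1⁆ = a • B 1) (h02 : ⁅B 0, B 2⁆ = b • B 2) (hab : a ≠ 0 ∨ b ≠ 0) :
    StronglyCancellative k (UniversalEnvelopingAlgebra k g) := by
  rcases eq_or_ne a 0 with rfl | ha
  · exact stronglyCancellative_of_central B h12 (by simpa using h01) h02 (by simpa using hab)
  rcases eq_or_ne b 0 with rfl | hb
  · refine stronglyCancellative_of_central (b := a) (B.reindex (Equiv.swap 1 2)) ?_ ?_ ?_ ha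
    · simp [← lie_skew (B 2), h12, Module.Basis.reindex_apply]
    · simpa [Module.Basis.reindex_apply, Equiv.swap_apply_of_ne_of_ne] using h02
    · simpa [Module.Basis.reindex_apply, Equiv.swap_apply_of_ne_of_ne] using h01
  obtain ⟨J, hJ, hJ0, hJ1, hc⟩ := semidirect_center (b := b) (c := 0) B h12 h01
    (by simp [h02]) (Or.inl ha)
  by_cases hm : ∃ m : Fin 2 →₀ ℕ, m ≠ 0 ∧ a * m 0 + b * m 1 = 0
  · obtain ⟨m, hm, hab⟩ := hm
    obtain ⟨m₀, h0, h1, hm₀⟩ := exists_generator ha hb hm hab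
    obtain ⟨d, hd, hdr, hdX⟩ := exists_center_generator hJ hc (m₀ := m₀)
      (by rintro rfl; simp at h0) (triangularDerivation_diag_eq_zero a b hm₀)
    refine stronglyCancellative_of_character d hd hdr (augmentation k g) fun χ => ?_
    have hχ : χ (J (X 0)) = 0 := by
      have := algHom_ι_lie χ (B 0) (B 1)
      rw [h01, map_smul, map_smul, smul_eq_zero, or_iff_right ha] at this
      rw [hJ0, this]
    have hdvd : (X 0 : MvPolynomial (Fin 2) k) ∣ monomial m₀ 1 := by
      rw [X_dvd_monomial]; exact Or.inr h0
    obtain ⟨r, hr⟩ := hdvd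
    rw [hdX, hr, map_mul, map_mul, hχ, zero_mul]
  · push Not at hm
    refine stronglyCancellative_of_ker_trivial J hJ fun z hz => ?_
    obtain ⟨p, hp, rfl⟩ := (hc z).mp hz
    obtain ⟨f, rfl⟩ := (triangularDerivation_diag_eq_zero a b (m₀ := 0) (fun m => by
      constructor
      · intro h
        exact ⟨0, by by_contra h0; exact hm m (by simpa using h0) h⟩
      · rintro ⟨t, rfl⟩; simp) p).mp hp
    refine ⟨Polynomial.eval 1 f, ?_⟩
    congr 1
    have : (Polynomial.aeval (monomial 0 (1 : k)) : Polynomial k →ₐ[k] MvPolynomial (Fin 2) k) =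
        (Algebra.ofId k _).comp (Polynomial.aeval 1) := by
      ext; simp
    rw [this]
    simp [Algebra.ofId_apply, algebraMap_eq]

theorem stronglyCancellative_of_jordan (h12 : ⁅B 1, B 2⁆ = 0)
    (h01 : ⁅B 0, B 1⁆ = a • B 1) (h02 : ⁅B 0, B 2⁆ = a • B 2 + c • B 1) (hc : c ≠ 0) :
    StronglyCancellative k (UniversalEnvelopingAlgebra k g) := by
  obtain ⟨J, hJ, hJ0, hJ1, hcent⟩ := semidirect_center B h12 h01 h02 (by simp [hc])
  rcases eq_or_ne a 0 with rfl | ha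
  · obtain ⟨d, hd, hdr, hdX⟩ := exists_center_generator hJ hcent (m₀ := Finsupp.single 0 1)
      (by simp) (triangularDerivation_nilpotent_eq_zero hc)
    refine stronglyCancellative_of_character d hd hdr (augmentation k g) fun χ => ?_
    rw [hdX]
    have := algHom_ι_lie χ (B 0) (B 2)
    rw [h02, zero_smul, zero_add, map_smul, map_smul, smul_eq_zero, or_iff_right hc] at this
    exact (congrArg χ hJ0).trans this
  · refine stronglyCancellative_of_ker_trivial J hJ fun z hz => ?_
    obtain ⟨p, hp, rfl⟩ := (hcent z).mp hz
    obtain ⟨r, rfl⟩ := triangularDerivation_jordan_eq_zero ha c hp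
    exact ⟨r, rfl⟩

end SemidirectCancellation

section SpecialLinear

open UniversalEnvelopingAlgebra MvPolynomial

section Shift

variable {k : Type*} [Field k]

/-- The substitution `h ↦ h + c` of `k[h, ω]`. -/
noncomputable def translate (c : k) : MvPolynomial (Fin 2) k →ₐ[k] MvPolynomial (Fin 2) k :=
  aeval ![X 0 + C c, X 1]

@[simp] lemma translate_X_zero (c : k) : translate c (X 0) = X 0 + C c := by simp [translate]

@[simp] lemma translate_X_one (c : k) : translate c (X 1) = X 1 := by simp [translate]

@[simp] lemma translate_C (c r : k) : translate c (C r) = C r := (translate c).commutes r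

lemma translate_zero : translate (0 : k) = AlgHom.id k _ := by
  ext i : 1; fin_cases i <;> simp

lemma translate_translate (c d : k) (p : MvPolynomial (Fin 2) k) :
    translate c (translate d p) = translate (c + d) p := by
  rw [← AlgHom.comp_apply]
  congr 1
  ext i : 1; fin_cases i <;> simp [add_assoc]

lemma translate_neg_translate (c : k) (p : MvPolynomial (Fin 2) k) :
    translate (-c) (translate c p) = p := by
  rw [translate_translate, neg_add_cancel, translate_zero]; rfl

lemma translate_translate_neg (c : k) (p : MvPolynomial (Fin 2) k) :
    translate c (translate (-c) p) = p := by
  rw [translate_translate, add_neg_cancel, translate_zero]; rfl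

lemma translate_injective (c : k) : Function.Injective (translate c) :=
  Function.LeftInverse.injective (translate_neg_translate c)

/-- The polynomials invariant under `h ↦ h + c` are those in `ω`. -/
lemma translate_eq_self [CharZero k] {c : k} (hc : c ≠ 0) (p : MvPolynomial (Fin 2) k) :
    translate c p = p ↔
      ∃ f : Polynomial k, Polynomial.aeval (monomial (Finsupp.single 1 1) (1 : k)) f = p := by
  constructor
  · intro hp
    refine ⟨aeval ![0, Polynomial.X] p, ?_⟩
    apply MvPolynomial.funext
    intro v
    have h1 (x y : k) : eval ![x + c, y] p = eval ![x, y] p := by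
      conv_rhs => rw [← hp, translate, ← aeval_eq_eval, ← AlgHom.comp_apply]
      rw [← aeval_eq_eval]
      congr 1
      ext i : 1; fin_cases i <;> simp
    have h2 (n : ℕ) (y : k) : eval ![n * c, y] p = eval ![0, y] p := by
      induction n with
      | zero => simp
      | succ n ih => rw [← ih, ← h1 (n * c), Nat.cast_succ, add_mul, one_mul]
    have h3 : eval v p = eval ![0, v 1] p := by
      let P : Polynomial k := aeval ![Polynomial.X, Polynomial.C (v 1)] p
      have hP (x : k) : P.eval x = eval ![x, v 1] p := by
        rw [← Polynomial.coe_aeval_eq_eval, ← aeval_eq_eval]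
        change ((Polynomial.aeval x).comp (aeval ![Polynomial.X, Polynomial.C (v 1)])) p = _
        congr 1
        ext i : 1; fin_cases i <;> simp
      have : P - Polynomial.C (eval ![0, v 1] p) = 0 := by
        apply Polynomial.eq_zero_of_infinite_isRoot
        refine (Set.infinite_range_of_injective (f := fun n : ℕ => (n : k) * c) ?_).mono ?_
        · intro m n h
          exact_mod_cast mul_right_cancel₀ hc h
        · rintro _ ⟨n, rfl⟩
          simp [hP, h2]
      have hv : v = ![v 0, v 1] := by ext i; fin_cases i <;> rfl
      conv_lhs => rw [hv, ← hP, sub_eq_zero.mp this]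
      simp
    rw [h3, ← aeval_eq_eval, ← aeval_eq_eval]
    change (((aeval v).comp (Polynomial.aeval (monomial (Finsupp.single 1 1) (1 : k)))).comp
      (aeval ![0, Polynomial.X])) p = _
    congr 1
    ext i : 1
    fin_cases i
    · simp
    · simp [show monomial (Finsupp.single (1 : Fin 2) 1) (1 : k) = X 1 from rfl]
  · rintro ⟨f, rfl⟩
    rw [← AlgHom.comp_apply]
    congr 1
    ext : 1
    simp [show monomial (Finsupp.single (1 : Fin 2) 1) (1 : k) = X 1 from rfl]

end Shift

section Operators

variable {k : Type*} [Field k]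

/-- The raising operator on `ℤ → k[h, ω]`. -/
noncomputable def raising (k : Type*) [Field k] :
    (ℤ → MvPolynomial (Fin 2) k) →ₗ[k] (ℤ → MvPolynomial (Fin 2) k) where
  toFun φ i := translate (-2) (φ (i - 1))
  map_add' φ ψ := by ext1 i; simp
  map_smul' r φ := by ext1 i; simp

/-- The polynomial representing `f * e`. -/
noncomputable def lowerRaise (k : Type*) [Field k] : MvPolynomial (Fin 2) k :=
  C 4⁻¹ * (X 1 - X 0 ^ 2 - 2 * X 0)

/-- The lowering operator on `ℤ → k[h, ω]`. -/
noncomputable def lowering (k : Type*) [Field k] :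
    (ℤ → MvPolynomial (Fin 2) k) →ₗ[k] (ℤ → MvPolynomial (Fin 2) k) where
  toFun φ i := lowerRaise k * translate 2 (φ (i + 1))
  map_add' φ ψ := by ext1 i; simp [mul_add]
  map_smul' r φ := by ext1 i; simp

lemma raising_apply (φ : ℤ → MvPolynomial (Fin 2) k) (i : ℤ) :
    raising k φ i = translate (-2) (φ (i - 1)) := rfl

lemma lowering_apply (φ : ℤ → MvPolynomial (Fin 2) k) (i : ℤ) :
    lowering k φ i = lowerRaise k * translate 2 (φ (i + 1)) := rfl

lemma four_mul_lowerRaise [CharZero k] : 4 * lowerRaise k = X 1 - X 0 ^ 2 - 2 * X 0 := by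
  rw [lowerRaise, ← mul_assoc, show (4 : MvPolynomial (Fin 2) k) = C 4 from (map_ofNat C 4).symm,
    ← C_mul, mul_inv_cancel₀ (by norm_num), C_1, one_mul]

lemma translate_lowerRaise [CharZero k] :
    translate (-2) (lowerRaise k) = lowerRaise k + X 0 := by
  apply mul_left_cancel₀ (show (4 : MvPolynomial (Fin 2) k) ≠ 0 by norm_num)
  have h := congrArg (translate (-2 : k)) (four_mul_lowerRaise (k := k))
  have h2 : (C (-2) : MvPolynomial (Fin 2) k) = -2 := by rw [C_neg, map_ofNat]
  simp only [map_mul, map_sub, map_pow, map_ofNat, translate_X_zero, translate_X_one, h2] at h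
  linear_combination h - four_mul_lowerRaise (k := k)

lemma lowerRaise_ne_zero [CharZero k] : lowerRaise k ≠ 0 := by
  intro h
  have := congrArg (eval ![0, 1]) (four_mul_lowerRaise (k := k))
  simp [h] at this

lemma raising_pow_single (n : ℕ) (p : MvPolynomial (Fin 2) k) :
    (raising k ^ n) (Pi.single 0 p) = Pi.single (n : ℤ) ((translate (-2))^[n] p) := by
  induction n with
  | zero => simp
  | succ n ih =>
    rw [pow_succ', Module.End.mul_apply, ih]
    ext1 i
    rw [raising_apply, Pi.single_apply, Pi.single_apply, Function.iterate_succ_apply']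
    simp only [Nat.cast_add, Nat.cast_one, sub_eq_iff_eq_add]
    split_ifs <;> simp

lemma exists_lowering_pow_single [CharZero k] (n : ℕ) : ∃ q : MvPolynomial (Fin 2) k, q ≠ 0 ∧
    ∀ p, (lowering k ^ n) (Pi.single 0 p) = Pi.single (-n : ℤ) (q * (translate 2)^[n] p) := by
  induction n with
  | zero => exact ⟨1, one_ne_zero, by simp⟩
  | succ n ih =>
    obtain ⟨q, hq, ih⟩ := ih
    refine ⟨lowerRaise k * translate 2 q, mul_ne_zero lowerRaise_ne_zero
      ((map_ne_zero_iff _ (translate_injective 2)).mpr hq), fun p => ?_⟩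
    rw [pow_succ', Module.End.mul_apply, ih]
    ext1 i
    rw [lowering_apply, Pi.single_apply, Pi.single_apply, Function.iterate_succ_apply']
    have : i + 1 = -(n : ℤ) ↔ i = -((n + 1 : ℕ) : ℤ) := by push_cast; omega
    simp only [this]
    split_ifs <;> simp [mul_assoc]

end Operators

end SpecialLinear

section SpecialLinearCentre

open UniversalEnvelopingAlgebra MvPolynomial

/-- The powers of `e` and `f`, indexed by their weights. -/
def weightPower {A : Type*} [Monoid A] (e f : A) : ℤ → A
  | (n : ℕ) => e ^ n
  | Int.negSucc n => f ^ (n + 1)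

section Abstract

variable {k A : Type*} [Field k] [CharZero k] [Ring A] [Algebra k A] {h e f : A}

lemma commute_casimir (he : h * e - e * h = 2 * e) (hf : h * f - f * h = -(2 * f))
    (hef : e * f - f * e = h) :
    h * (4 * (f * e) + h ^ 2 + 2 * h) = (4 * (f * e) + h ^ 2 + 2 * h) * h ∧
    e * (4 * (f * e) + h ^ 2 + 2 * h) = (4 * (f * e) + h ^ 2 + 2 * h) * e ∧
    f * (4 * (f * e) + h ^ 2 + 2 * h) = (4 * (f * e) + h ^ 2 + 2 * h) * f := by
  have hu : e * f - f * e - h = 0 := sub_eq_zero.mpr hef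
  have hv : e * h - h * e + 2 * e = 0 := by rw [← he]; abel
  have hx : f * h - h * f - 2 * f = 0 := by
    rw [show f * h - h * f - 2 * f = -(h * f - f * h + 2 * f) by abel, hf]; abel
  refine ⟨?_, ?_, ?_⟩ <;> rw [← sub_eq_zero]
  · calc _ = -4 * ((f * h - h * f - 2 * f) * e) - 4 * (f * (e * h - h * e + 2 * e)) := by
          noncomm_ring
      _ = 0 := by rw [hv, hx]; simp
  · calc _ = 4 * ((e * f - f * e - h) * e) + (e * h - h * e + 2 * e) * h +
          h * (e * h - h * e + 2 * e) := by noncomm_ring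
      _ = 0 := by rw [hu, hv]; simp
  · calc _ = -4 * (f * (e * f - f * e - h)) + (f * h - h * f - 2 * f) * h +
          h * (f * h - h * f - 2 * f) := by noncomm_ring
      _ = 0 := by rw [hu, hx]; simp

/-- The centre of the enveloping algebra of `sl₂`. -/
lemma sl2_center (he : h * e - e * h = 2 * e) (hf : h * f - f * h = -(2 * f))
    (hef : e * f - f * e = h) (hgen : Algebra.adjoin k {h, e, f} = ⊤)
    (Φ : A →ₐ[k] Module.End k (ℤ → MvPolynomial (Fin 2) k))
    (hΦh : ∀ φ, Φ h φ = (X 0 : MvPolynomial (Fin 2) k) • φ) (hΦe : Φ e = raising k)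
    (hΦf : Φ f = lowering k) :
    ∃ J : MvPolynomial (Fin 2) k →ₐ[k] A, Function.Injective J ∧
      J (X 1) = 4 * (f * e) + h ^ 2 + 2 * h ∧
      ∀ z, z ∈ Subalgebra.center k A ↔ ∃ p, translate (-2) p = p ∧ J p = z := by
  obtain ⟨hΩh, hΩe, hΩf⟩ := commute_casimir he hf hef
  obtain ⟨J, hJ0, hJ1⟩ := exists_algHom_of_commute (k := k) hΩh
  have hJC (r : k) : J (C r) = algebraMap k A r := J.commutes r
  have hA2 : algebraMap k A 2 = 2 := map_ofNat _ 2
  have hJe (p) : e * J p = J (translate (-2) p) * e := by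
    induction p using MvPolynomial.induction_on with
    | C r => rw [translate_C, hJC, Algebra.commutes]
    | add p q hp hq => simp only [map_add, mul_add, add_mul, hp, hq]
    | mul_X p i hp =>
      have hi : e * J (X i) = J (translate (-2) (X i)) * e := by
        fin_cases i
        · simp [hJ0, hJC, hA2, add_mul, ← he]
        · simp [hJ1, hΩe]
      rw [map_mul, ← mul_assoc, hp, mul_assoc, hi, map_mul, map_mul, mul_assoc]
  have hJf (p) : f * J p = J (translate 2 p) * f := by
    induction p using MvPolynomial.induction_on with
    | C r => rw [translate_C, hJC, Algebra.commutes]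
    | add p q hp hq => simp only [map_add, mul_add, add_mul, hp, hq]
    | mul_X p i hp =>
      have hi : f * J (X i) = J (translate 2 (X i)) * f := by
        fin_cases i
        · simp [hJ0, hJC, hA2, add_mul, eq_add_of_sub_eq hf]
        · simp [hJ1, hΩf]
      rw [map_mul, ← mul_assoc, hp, mul_assoc, hi, map_mul, map_mul, mul_assoc]
  have hfe : f * e = J (lowerRaise k) := by
    have h4 : (4 : A) * J (lowerRaise k) = 4 * (f * e) := by
      have h2 : J 2 = 2 := map_ofNat J 2
      have h4 : J 4 = 4 := map_ofNat J 4
      rw [← h4, ← map_mul, four_mul_lowerRaise, h4]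
      simp only [map_sub, map_mul, map_pow, hJ0, hJ1, h2]
      abel
    have := congrArg (fun a => algebraMap k A 4⁻¹ * a) h4
    simp only [← mul_assoc] at this
    rw [← map_ofNat (algebraMap k A) 4, ← map_mul, inv_mul_cancel₀ (by norm_num)] at this
    simpa using this.symm
  have hef' : e * f = J (translate (-2) (lowerRaise k)) := by
    rw [translate_lowerRaise, map_add, ← hfe, hJ0, ← hef]; abel
  have hΦJ (p φ) : Φ (J p) φ = p • φ := by
    have : Φ.comp J = Algebra.lsmul k k (ℤ → MvPolynomial (Fin 2) k) := by
      ext1 i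
      fin_cases i
      · ext1 φ
        simp [hJ0, hΦh]
      · ext φ n : 2
        simp only [AlgHom.comp_apply, Fin.mk_one, hJ1, map_add, map_mul, map_ofNat, hΦe,
          hΦf, pow_two]
        have : X 1 = 4 * lowerRaise k + X 0 * X 0 + 2 * X 0 := by
          rw [four_mul_lowerRaise]; ring
        simp [hΦh, Module.End.ofNat_apply, raising_apply, lowering_apply,
          translate_translate_neg, this]
        ring
    exact LinearMap.congr_fun (DFunLike.congr_fun this p) φ
  have hw0 : weightPower e f 0 = 1 := pow_zero e
  have hspan : Submodule.span k {a | ∃ p i, a = J p * weightPower e f i} = ⊤ := by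
    have key := mul_mem_of_adjoin_eq_top hgen
      (Submodule.span k {a | ∃ p i, a = J p * weightPower e f i}) (by
        intro a ha m hm
        refine Submodule.span_induction (p := fun m _ => a * m ∈ _) ?_ (by simp)
          (fun x y _ _ hx hy => by rw [mul_add]; exact Submodule.add_mem _ hx hy)
          (fun r x _ hx => by rw [mul_smul_comm]; exact Submodule.smul_mem _ r hx) hm
        rintro _ ⟨p, i, rfl⟩
        apply Submodule.subset_span
        rcases ha with rfl | rfl | rfl
        · exact ⟨X 0 * p, i, by rw [map_mul, hJ0, mul_assoc]⟩
        · rw [← mul_assoc, hJe]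
          obtain n | n := i
          · exact ⟨_, (n + 1 : ℕ), by rw [mul_assoc]; exact congrArg _ (pow_succ' a n).symm⟩
          · refine ⟨translate (-2) p * translate (-2) (lowerRaise k), -(n : ℤ), ?_⟩
            have : weightPower a f (-(n : ℤ)) = f ^ n := by
              cases n with
              | zero => rw [pow_zero]; exact pow_zero a
              | succ n => rfl
            rw [this, map_mul, ← hef', mul_assoc, mul_assoc, mul_assoc, ← pow_succ']
            rfl
        · rw [← mul_assoc, hJf]
          obtain (_ | n) | n := i
          · have h0 : weightPower e a (Int.ofNat 0) = 1 := pow_zero e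
            have h1 : weightPower e a (-1) = a := pow_one a
            exact ⟨translate 2 p, -1, by rw [h0, h1, mul_one]⟩
          · refine ⟨translate 2 p * lowerRaise k, n, ?_⟩
            have : weightPower e a n = e ^ n := rfl
            rw [this, map_mul, ← hfe, mul_assoc, mul_assoc, mul_assoc, ← pow_succ']
            rfl
          · exact ⟨_, Int.negSucc (n + 1), by
              rw [mul_assoc]; exact congrArg _ (pow_succ' a (n + 1)).symm⟩)
    refine eq_top_iff.mpr fun a _ => ?_
    simpa using key a 1 (Submodule.subset_span ⟨1, 0, by simp [hw0]⟩)
  have hweight (i : ℤ) : ∃ q : MvPolynomial (Fin 2) k, q ≠ 0 ∧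
      ∀ p, Φ (weightPower e f i) (Pi.single 0 p) =
        Pi.single i (q * translate (-(2 * i) : k) p) := by
    have hiter (c : k) (n : ℕ) (p) : (translate c)^[n] p = translate (n * c) p := by
      induction n with
      | zero => simp [translate_zero]
      | succ n ih =>
        rw [Function.iterate_succ_apply', ih, translate_translate]
        push_cast
        ring_nf
    obtain n | n := i
    · refine ⟨1, one_ne_zero, fun p => ?_⟩
      change Φ (e ^ n) _ = _
      rw [map_pow, hΦe, raising_pow_single, hiter, one_mul]
      congr 3
      simp; ring
    · obtain ⟨q, hq, h⟩ := exists_lowering_pow_single (k := k) (n + 1)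
      refine ⟨q, hq, fun p => ?_⟩
      change Φ (f ^ (n + 1)) _ = _
      rw [map_pow, hΦf, h, hiter]
      congr 4
      push_cast [Int.negSucc_eq]; ring
  have hfaith {a : A} (ha : Φ a (Pi.single 0 1) = 0) : a = 0 := by
    obtain ⟨s, rfl⟩ : ∃ s : ℤ →₀ MvPolynomial (Fin 2) k,
        s.sum (fun i p => J p * weightPower e f i) = a := by
      have ha : a ∈ Submodule.span k {a | ∃ p i, a = J p * weightPower e f i} :=
        hspan ▸ Submodule.mem_top
      clear * - ha
      induction ha using Submodule.span_induction with
      | mem x h =>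
        obtain ⟨p, i, rfl⟩ := h
        exact ⟨Finsupp.single i p, Finsupp.sum_single_index (by simp)⟩
      | zero => exact ⟨0, by simp⟩
      | add x y _ _ hx hy =>
        obtain ⟨s, rfl⟩ := hx
        obtain ⟨t, rfl⟩ := hy
        exact ⟨s + t, Finsupp.sum_add_index' (by simp) (by simp [add_mul])⟩
      | smul r x _ hx =>
        obtain ⟨s, rfl⟩ := hx
        exact ⟨r • s, by rw [Finsupp.sum_smul_index' (by simp), Finsupp.smul_sum]; simp⟩
    suffices s = 0 by simp [this]
    choose q hq hΦq using hweight
    ext1 i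
    have := congrFun ha i
    rw [Finsupp.sum, map_sum, LinearMap.sum_apply, Finset.sum_apply] at this
    simp only [map_mul, Module.End.mul_apply, hΦJ, hΦq, map_one, mul_one, Pi.smul_apply] at this
    rw [Finset.sum_eq_single i (fun j _ hj => by simp [hj.symm])
      (fun hi => by simp [Finsupp.notMem_support_iff.mp hi])] at this
    simpa [hq i] using this
  refine ⟨J, fun p q hpq => ?_, hJ1, fun z => ⟨fun hz => ?_, ?_⟩⟩
  · have := congrFun (congrArg (fun a => Φ a (Pi.single 0 1)) hpq) 0
    simpa [hΦJ] using this
  · have hcomm := fun a => Subalgebra.mem_center_iff.mp hz a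
    have hX (a : A) (i : ℤ) : Φ a (Pi.single 0 (X 0)) i =
        (X 0 - C (2 * i : k)) * Φ a (Pi.single 0 1) i := by
      have ha : a ∈ Submodule.span k {a | ∃ p i, a = J p * weightPower e f i} :=
        hspan ▸ Submodule.mem_top
      induction ha using Submodule.span_induction with
      | mem x h =>
        obtain ⟨p, j, rfl⟩ := h
        obtain ⟨q, -, hΦq⟩ := hweight j
        rw [map_mul, Module.End.mul_apply, Module.End.mul_apply, hΦJ, hΦJ, hΦq, hΦq]
        rcases eq_or_ne i j with rfl | hij
        · simp; ring
        · simp [hij]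
      | zero => simp
      | add x y _ _ hx hy => simp [hx, hy, mul_add]
      | smul r x _ hx => simp [hx]
    have hi (i : ℤ) (h0 : i ≠ 0) : Φ z (Pi.single 0 1) i = 0 := by
      have h1 := congrFun (congrArg (fun a => Φ a (Pi.single 0 1)) (hcomm h)) i
      have h2 : (X 0 : MvPolynomial (Fin 2) k) • (Pi.single 0 1 : ℤ → MvPolynomial (Fin 2) k) =
          (Pi.single 0 (X 0) : ℤ → MvPolynomial (Fin 2) k) := by rw [← Pi.single_smul]; simp
      simp only [map_mul, Module.End.mul_apply, hΦh, h2, hX, Pi.smul_apply, smul_eq_mul] at h1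
      have h3 : (C (2 * i : k) : MvPolynomial (Fin 2) k) * Φ z (Pi.single 0 1) i = 0 := by
        rw [map_mul]
        linear_combination h1
      simpa [h0] using h3
    set p := Φ z (Pi.single 0 1) 0 with hp
    have hzJ : J p = z := by
      rw [← sub_eq_zero]
      apply hfaith
      ext1 i
      rcases eq_or_ne i 0 with rfl | h0
      · simp [hΦJ, ← hp]
      · simp [hΦJ, hi i h0, h0]
    refine ⟨p, ?_, hzJ⟩
    have h1 := hcomm e
    rw [← hzJ, hJe] at h1
    have h2 := congrFun (congrArg (fun a => Φ a (Pi.single 0 1)) h1) 1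
    have h3 : raising k (Pi.single 0 1) = Pi.single (1 : ℤ) 1 := by
      simpa using raising_pow_single (k := k) 1 1
    simpa [hΦJ, hΦe, h3] using h2
  · rintro ⟨p, hp, rfl⟩
    have hp2 : translate 2 p = p := by conv_lhs => rw [← hp, translate_translate_neg]
    refine mem_center_of_adjoin_eq_top hgen ?_
    rintro a (rfl | rfl | rfl)
    · rw [← hJ0, ← map_mul, mul_comm, map_mul]
    · rw [hJe, hp]
    · rw [hJf, hp2]

end Abstract

variable {k : Type u} [Field k] [CharZero k] {g : Type u} [LieRing g] [LieAlgebra k g]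

theorem stronglyCancellative_of_sl2 (B : Module.Basis (Fin 3) k g)
    (h01 : ⁅B 0, B 1⁆ = (2 : k) • B 1) (h02 : ⁅B 0, B 2⁆ = (-2 : k) • B 2)
    (h12 : ⁅B 1, B 2⁆ = B 0) : StronglyCancellative k (UniversalEnvelopingAlgebra k g) := by
  have h2 : (2 : k) ≠ 0 := two_ne_zero
  let mul : MvPolynomial (Fin 2) k →ₐ[k] Module.End k (ℤ → MvPolynomial (Fin 2) k) :=
    Algebra.lsmul k k _
  have hmul (p φ) : mul p φ = p • φ := rfl
  have hC : (C (2 : k) : MvPolynomial (Fin 2) k) = 2 := map_ofNat C 2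
  obtain ⟨Φ, hΦ⟩ := exists_lift_of_basis B ![mul (X 0), raising k, lowering k]
    (by
      rw [h01, map_smul, Module.Basis.constr_basis]
      ext φ i : 2
      simp [hmul, raising_apply, smul_eq_C_mul, hC]
      ring)
    (by
      rw [h02, map_smul, Module.Basis.constr_basis]
      ext φ i : 2
      simp [hmul, lowering_apply, smul_eq_C_mul, hC]
      ring)
    (by
      rw [h12, Module.Basis.constr_basis]
      ext φ i : 2
      simp [hmul, raising_apply, lowering_apply, translate_neg_translate, translate_translate_neg,
        translate_lowerRaise]
      ring)
  have ofNat_smul (x : UniversalEnvelopingAlgebra k g) : (2 : k) • x = 2 * x := by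
    rw [Algebra.smul_def, map_ofNat]
  obtain ⟨J, hJ, hJ1, hc⟩ := sl2_center (k := k) (h := ι k (B 0)) (e := ι k (B 1)) (f := ι k (B 2))
    (by rw [← ι_lie, h01, map_smul, ofNat_smul])
    (by rw [← ι_lie, h02, neg_smul, map_neg, map_smul, ofNat_smul])
    (by rw [← ι_lie, h12])
    (by
      rw [← adjoin_range_ι_basis B]
      congr 1
      ext x
      simp [Fin.exists_fin_succ, -ι_apply, eq_comm])
    Φ (fun φ => by rw [hΦ 0]; rfl) (hΦ 1) (hΦ 2)
  obtain ⟨d, hd, hdr, hdX⟩ := exists_center_generator hJ hc (m₀ := Finsupp.single 1 1) (by simp)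
    (translate_eq_self (neg_ne_zero.mpr h2))
  refine stronglyCancellative_of_character d hd hdr (augmentation k g) fun χ => ?_
  have hχ0 : χ (ι k (B 0)) = 0 := by rw [← h12, algHom_ι_lie]
  have hχ1 : χ (ι k (B 1)) = 0 := by
    have := algHom_ι_lie χ (B 0) (B 1)
    rwa [h01, map_smul, map_smul, smul_eq_zero, or_iff_right h2] at this
  rw [hdX, show monomial (Finsupp.single (1 : Fin 2) 1) (1 : k) = X 1 from rfl, hJ1]
  simp [hχ0, hχ1, -ι_apply]

end SpecialLinearCentre

section Classification

open Module

lemma exists_eigenvalue_ne_zero {k V : Type*} [Field k] [IsAlgClosed k] [AddCommGroup V]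
    [Module k V] [FiniteDimensional k V] {T : End k V} (hT : ¬ IsNilpotent T) :
    ∃ a, a ≠ 0 ∧ T.HasEigenvalue a := by
  by_contra! h
  refine hT (T.isNilpotent_iff_charpoly.mpr ?_)
  have hroots : T.charpoly.roots = Multiset.replicate (finrank k V) 0 := by
    rw [Multiset.eq_replicate, ← T.charpoly_natDegree]
    refine ⟨(IsAlgClosed.splits _).natDegree_eq_card_roots.symm, fun a ha => ?_⟩
    by_contra h0
    exact h a h0 ((End.hasEigenvalue_iff_isRoot_charpoly _ _).mpr
      (Polynomial.isRoot_of_mem_roots ha))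
  conv_lhs => rw [(IsAlgClosed.splits T.charpoly).eq_prod_roots_of_monic T.charpoly_monic, hroots]
  simp

variable {k : Type u} [Field k] {g : Type u} [LieRing g] [LieAlgebra k g]

lemma exists_basis_of_linearIndependent (hdim : finrank k g = 3) {x y z : g}
    (h : LinearIndependent k ![x, y, z]) :
    ∃ B : Basis (Fin 3) k g, B 0 = x ∧ B 1 = y ∧ B 2 = z := by
  refine ⟨basisOfLinearIndependentOfCardEqFinrank h (by simp [hdim]), ?_, ?_, ?_⟩ <;> simp

lemma linearIndependent_cons_of_ker {ℓ : g →ₗ[k] k} {e x y : g} (he : ℓ e ≠ 0) (hx : ℓ x = 0)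
    (hy : ℓ y = 0) (hxy : LinearIndependent k ![x, y]) : LinearIndependent k ![e, x, y] := by
  refine linearIndependent_finCons.mpr ⟨hxy, fun h => he ?_⟩
  have : Submodule.span k (Set.range ![x, y]) ≤ LinearMap.ker ℓ := by
    rw [Submodule.span_le]
    rintro _ ⟨i, rfl⟩
    fin_cases i <;> simp [hx, hy]
  exact this h

lemma exists_eq_smul_add_smul_of_ker (hdim : finrank k g = 3) {ℓ : g →ₗ[k] k} {e x y : g}
    (he : ℓ e ≠ 0) (hx : ℓ x = 0) (hy : ℓ y = 0) (hxy : LinearIndependent k ![x, y])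
    {w : g} (hw : ℓ w = 0) : ∃ a b : k, w = a • x + b • y := by
  obtain ⟨B, rfl, rfl, rfl⟩ := exists_basis_of_linearIndependent hdim
    (linearIndependent_cons_of_ker he hx hy hxy)
  have h := B.sum_repr w
  rw [Fin.sum_univ_three] at h
  have h0 : B.repr w 0 = 0 := by
    have := congrArg ℓ h
    simpa [hx, hy, hw, he] using this
  exact ⟨B.repr w 1, B.repr w 2, by rw [← h]; simp [h0]⟩

lemma lie_eq_zero_of_basis (B : Basis (Fin 3) k g) (h01 : ⁅B 0, B 1⁆ = 0) (h02 : ⁅B 0, B 2⁆ = 0)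
    (h12 : ⁅B 1, B 2⁆ = 0) (x y : g) : ⁅x, y⁆ = 0 := by
  have h10 : ⁅B 1, B 0⁆ = 0 := by rw [← lie_skew, h01, neg_zero]
  have h20 : ⁅B 2, B 0⁆ = 0 := by rw [← lie_skew, h02, neg_zero]
  have h21 : ⁅B 2, B 1⁆ = 0 := by rw [← lie_skew, h12, neg_zero]
  have : (LieAlgebra.ad k g : g →ₗ[k] End k g) = 0 := by
    refine B.ext fun i => B.ext fun j => ?_
    fin_cases i <;> fin_cases j <;> simp [h01, h02, h12, h10, h20, h21]
  exact LinearMap.congr_fun (LinearMap.congr_fun this x) y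

/-- The case of an abelian ideal of codimension one. -/
theorem stronglyCancellative_of_abelian_ker [IsAlgClosed k] [CharZero k] (hdim : finrank k g = 3)
    (hnonab : ¬ ∀ x y : g, ⁅x, y⁆ = 0) {ℓ : g →ₗ[k] k} (hℓ0 : ℓ ≠ 0) (hℓ : ∀ x y : g, ℓ ⁅x, y⁆ = 0)
    (hab : ∀ x y : g, ℓ x = 0 → ℓ y = 0 → ⁅x, y⁆ = 0) :
    StronglyCancellative k (UniversalEnvelopingAlgebra k g) := by
  have : FiniteDimensional k g := .of_finrank_pos (by omega)
  obtain ⟨e, he⟩ : ∃ e, ℓ e ≠ 0 := by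
    by_contra! h
    exact hℓ0 (LinearMap.ext h)
  have hker : finrank k (LinearMap.ker ℓ) = 2 := by
    have := Module.Dual.finrank_ker_add_one_of_ne_zero hℓ0
    omega
  have : Nontrivial (LinearMap.ker ℓ) := nontrivial_of_finrank_pos (R := k) (by omega)
  obtain ⟨a, ha⟩ := End.exists_eigenvalue
    ((LieAlgebra.ad k g e).restrict (p := LinearMap.ker ℓ) fun x _ => hℓ e x)
  obtain ⟨x, hx⟩ := ha.exists_hasEigenvector
  obtain ⟨y, hxy⟩ := exists_linearIndependent_pair_of_one_lt_finrank (R := k) (by omega) hx.2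
  have hex : ⁅e, (x : g)⁆ = a • (x : g) := congrArg Subtype.val hx.apply_eq_smul
  replace hxy : LinearIndependent k ![(x : g), y] := by
    have hval : (LinearMap.ker ℓ).subtype ∘ ![x, y] = ![(x : g), y] := by
      ext i; fin_cases i <;> rfl
    exact hval ▸ hxy.map' (LinearMap.ker ℓ).subtype (Submodule.ker_subtype _)
  obtain ⟨x, hx0⟩ := x
  obtain ⟨y, hy0⟩ := y
  rw [LinearMap.mem_ker] at hx0 hy0
  obtain ⟨c, b, hey⟩ := exists_eq_smul_add_smul_of_ker hdim he hx0 hy0 hxy (hℓ e y)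
  rw [add_comm] at hey
  rcases eq_or_ne b a with rfl | hba
  · obtain ⟨B, rfl, rfl, rfl⟩ := exists_basis_of_linearIndependent hdim
      (linearIndependent_cons_of_ker he hx0 hy0 hxy)
    have h12 := hab _ _ hx0 hy0
    rcases eq_or_ne c 0 with rfl | hc
    · refine stronglyCancellative_of_diagonal B h12 hex (by simpa using hey) (.inl ?_)
      rintro rfl
      exact hnonab (lie_eq_zero_of_basis B (by simpa using hex) (by simpa using hey) h12)
    · exact stronglyCancellative_of_jordan B h12 hex hey hc
  · have hba' := sub_ne_zero.mpr hba
    obtain ⟨B, rfl, rfl, hB⟩ := exists_basis_of_linearIndependent hdim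
      (linearIndependent_cons_of_ker (y := (c / (b - a)) • x + y) he hx0 (by simp [hx0, hy0])
        (by simpa using hxy))
    refine stronglyCancellative_of_diagonal (a := a) (b := b) B ?_ hex ?_ ?_
    · rw [hB, lie_add, lie_smul, lie_self, hab _ _ hx0 hy0]; simp
    · rw [hB, lie_add, lie_smul, hex, hey]
      match_scalars <;> field_simp
      ring
    · contrapose! hba
      rw [hba.1, hba.2]

/-- The case of a nonabelian ideal of codimension one. -/
theorem stronglyCancellative_of_nonabelian_ker [IsAlgClosed k] [CharZero k]
    (hdim : finrank k g = 3) {ℓ : g →ₗ[k] k} (hℓ0 : ℓ ≠ 0) (hℓ : ∀ x y : g, ℓ ⁅x, y⁆ = 0) {u v : g}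
    (hu : ℓ u = 0) (hv : ℓ v = 0) (huv : ⁅u, v⁆ ≠ 0) :
    StronglyCancellative k (UniversalEnvelopingAlgebra k g) := by
  obtain ⟨e, he⟩ : ∃ e, ℓ e ≠ 0 := by
    by_contra! h
    exact hℓ0 (LinearMap.ext h)
  have indep {x y : g} (h : ⁅x, y⁆ ≠ 0) : LinearIndependent k ![x, y] := by
    refine LinearIndependent.pair_iff.mpr fun s t hst => ⟨?_, ?_⟩
    · have := congrArg (⁅·, y⁆) hst
      simpa [h] using this
    · have := congrArg (⁅x, ·⁆) hst
      simpa [h] using this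
  obtain ⟨w, hw⟩ : ∃ w, ⁅u, v⁆ = w := ⟨_, rfl⟩
  have hw0 : w ≠ 0 := hw ▸ huv
  have hℓw : ℓ w = 0 := hw ▸ hℓ u v
  obtain ⟨x, hx, hxw⟩ : ∃ x, ℓ x = 0 ∧ ⁅x, w⁆ = w := by
    obtain ⟨p, q, hpq⟩ := exists_eq_smul_add_smul_of_ker hdim he hu hv (indep huv) hℓw
    have huw : ⁅u, w⁆ = q • w := by
      conv_lhs => rw [hpq]
      simp [hw]
    have hvw : ⁅v, w⁆ = -p • w := by
      conv_lhs => rw [hpq]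
      simp [← lie_skew v u, hw]
    by_cases hq : q = 0
    · have hp : p ≠ 0 := by
        rintro rfl
        exact hw0 (by simpa [hq] using hpq)
      exact ⟨(-p)⁻¹ • v, by simp [hv], by
        rw [smul_lie, hvw, inv_smul_smul₀ (neg_ne_zero.mpr hp)]⟩
    · exact ⟨q⁻¹ • u, by simp [hu], by rw [smul_lie, huw, inv_smul_smul₀ hq]⟩
  have hli : LinearIndependent k ![x, w] := indep (by rwa [hxw])
  obtain ⟨δ, α, hew⟩ := exists_eq_smul_add_smul_of_ker hdim he hx hℓw hli (hℓ e w)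
  obtain ⟨ε, γ, hex⟩ := exists_eq_smul_add_smul_of_ker hdim he hx hℓw hli (hℓ e x)
  have hjac := leibniz_lie e x w
  rw [hxw, hew, hex] at hjac
  simp only [add_lie, smul_lie, lie_add, lie_smul, hxw, lie_self, smul_zero, add_zero, zero_add]
    at hjac
  have hδε := LinearIndependent.pair_iff.mp hli δ (-ε) (by
    rw [neg_smul, ← sub_eq_add_neg, sub_eq_zero]; exact add_right_cancel hjac)
  obtain ⟨rfl, hε⟩ := hδε
  obtain rfl : ε = 0 := by simpa using hε
  rw [zero_smul, zero_add] at hew hex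
  have hwx : ⁅w, x⁆ = -w := by rw [← lie_skew, hxw]
  obtain ⟨B, hB0, rfl, rfl⟩ := exists_basis_of_linearIndependent hdim
    (linearIndependent_cons_of_ker (e := e - α • x + γ • w) (by simpa [hx, hℓw] using he)
      hx hℓw hli)
  have h01 : ⁅B 0, B 1⁆ = 0 := by
    rw [hB0]; simp [hex, hwx]
  have h02 : ⁅B 0, B 2⁆ = 0 := by
    rw [hB0]; simp [hew, hxw]
  refine stronglyCancellative_of_diagonal (a := 1) (b := 0) (B.reindex (finRotate 3).symm)
    ?_ ?_ ?_ (.inl one_ne_zero)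
  · simp only [Basis.reindex_apply, Equiv.symm_symm]
    change ⁅B 2, B 0⁆ = 0
    rw [← lie_skew, h02, neg_zero]
  · simp only [Basis.reindex_apply, Equiv.symm_symm]
    change ⁅B 1, B 2⁆ = (1 : k) • B 2
    rw [hxw, one_smul]
  · simp only [Basis.reindex_apply, Equiv.symm_symm]
    change ⁅B 1, B 0⁆ = (0 : k) • B 0
    rw [← lie_skew, h01, neg_zero, zero_smul]

/-- A nonzero Lie algebra without nontrivial characters has an element whose adjoint action is not
nilpotent. -/
lemma exists_ad_not_isNilpotent [FiniteDimensional k g] [Nontrivial g]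
    (hperf : ∀ ℓ : g →ₗ[k] k, (∀ x y : g, ℓ ⁅x, y⁆ = 0) → ℓ = 0) :
    ∃ h : g, ¬ IsNilpotent (LieAlgebra.ad k g h) := by
  by_contra! h
  have hnil : LieRing.IsNilpotent g := (LieAlgebra.isNilpotent_iff_forall (R := k)).mpr h
  have hlt := LieAlgebra.derivedSeries_lt_top_of_solvable k g
  obtain ⟨ℓ, hℓ0, hℓ⟩ := Submodule.exists_le_ker_of_lt_top
    (LieAlgebra.derivedSeries k g 1).toSubmodule (lt_top_iff_ne_top.mpr fun h =>
      hlt.ne (LieSubmodule.toSubmodule_injective h))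
  exact hℓ0 (hperf ℓ fun x y => hℓ (LieSubmodule.lie_mem_lie (LieSubmodule.mem_top x)
    (LieSubmodule.mem_top y)))

lemma injective_zero_two_neg_two [CharZero k] : Function.Injective ![(0 : k), 2, -2] := by
  have h : (2 : k) ≠ -2 := fun h => two_ne_zero (self_eq_neg.mp h)
  intro i j hij
  fin_cases i <;> fin_cases j <;> simp [h, h.symm] at hij ⊢

theorem stronglyCancellative_of_sl2_triple [CharZero k] (hdim : finrank k g = 3) {h e f : g}
    (h0 : h ≠ 0) (hhe : ⁅h, e⁆ = (2 : k) • e) (hhf : ⁅h, f⁆ = (-2 : k) • f) (hef : ⁅e, f⁆ = h) :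
    StronglyCancellative k (UniversalEnvelopingAlgebra k g) := by
  have he0 : e ≠ 0 := by
    rintro rfl
    exact h0 (by rw [← hef, zero_lie])
  have hf0 : f ≠ 0 := by
    rintro rfl
    exact h0 (by rw [← hef, lie_zero])
  have hli : LinearIndependent k ![h, e, f] := by
    refine End.eigenvectors_linearIndependent' (LieAlgebra.ad k g h) ![0, 2, -2]
      injective_zero_two_neg_two _ fun i => ?_
    fin_cases i
    · exact End.hasEigenvector_iff.mpr ⟨End.mem_eigenspace_iff.mpr (by simp), h0⟩
    · exact End.hasEigenvector_iff.mpr ⟨End.mem_eigenspace_iff.mpr hhe, he0⟩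
    · exact End.hasEigenvector_iff.mpr ⟨End.mem_eigenspace_iff.mpr hhf, hf0⟩
  obtain ⟨B, rfl, rfl, rfl⟩ := exists_basis_of_linearIndependent hdim hli
  exact stronglyCancellative_of_sl2 B hhe hhf hef

/-- The case of a perfect Lie algebra. -/
theorem stronglyCancellative_of_perfect [IsAlgClosed k] [CharZero k] (hdim : finrank k g = 3)
    (hperf : ∀ ℓ : g →ₗ[k] k, (∀ x y : g, ℓ ⁅x, y⁆ = 0) → ℓ = 0) :
    StronglyCancellative k (UniversalEnvelopingAlgebra k g) := by
  have : FiniteDimensional k g := .of_finrank_pos (by omega)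
  have : Nontrivial g := nontrivial_of_finrank_pos (R := k) (by omega)
  have h2 : (2 : k) ≠ 0 := two_ne_zero
  obtain ⟨h, e, he0, hhe⟩ : ∃ h e : g, e ≠ 0 ∧ ⁅h, e⁆ = (2 : k) • e := by
    obtain ⟨h, hh⟩ := exists_ad_not_isNilpotent hperf
    obtain ⟨a, ha, hev⟩ := exists_eigenvalue_ne_zero hh
    obtain ⟨e, he⟩ := hev.exists_hasEigenvector
    have hhe : ⁅h, e⁆ = a • e := he.apply_eq_smul
    exact ⟨(2 / a) • h, e, he.2, by rw [smul_lie, hhe, smul_smul, div_mul_cancel₀ _ ha]⟩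
  have hli : LinearIndependent k ![h, e] := by
    refine LinearIndependent.pair_iff.mpr fun s t hst => ⟨?_, ?_⟩
    · have := congrArg (⁅·, e⁆) hst
      simpa [hhe, he0, h2] using this
    · have := congrArg (⁅h, ·⁆) hst
      simpa [hhe, he0, h2] using this
  obtain ⟨f, hf⟩ := exists_linearIndependent_cons_of_lt_finrank hli (by omega)
  obtain ⟨B, rfl, rfl, rfl⟩ := exists_basis_of_linearIndependent hdim hf
  obtain ⟨μ, α, β, hhf⟩ : ∃ μ α β : k, ⁅B 1, B 0⁆ = μ • B 0 + α • B 1 + β • B 2 :=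
    ⟨_, _, _, by rw [← Fin.sum_univ_three (fun i => B.repr ⁅B 1, B 0⁆ i • B i), B.sum_repr]⟩
  obtain ⟨c, d, q, hef⟩ : ∃ c d q : k, ⁅B 2, B 0⁆ = c • B 0 + d • B 1 + q • B 2 :=
    ⟨_, _, _, by rw [← Fin.sum_univ_three (fun i => B.repr ⁅B 2, B 0⁆ i • B i), B.sum_repr]⟩
  have heh : ⁅B 2, B 1⁆ = -((2 : k) • B 2) := by rw [← lie_skew, hhe]
  have hjac := leibniz_lie (B 1) (B 2) (B 0)
  simp only [hef, hhe, hhf, heh, lie_add, lie_smul, smul_lie, lie_self] at hjac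
  have hj0 := congrArg (fun z => B.repr z 0) hjac
  have hj1 := congrArg (fun z => B.repr z 1) hjac
  have hj2 := congrArg (fun z => B.repr z 2) hjac
  simp at hj0 hj1 hj2
  obtain rfl : c = 0 := by
    have : 2 * c = 0 := by linear_combination -hj0
    simpa using this
  have hvanish (ℓ : g →ₗ[k] k) (h1 : ℓ (B 2) = 0) (h3 : ℓ ⁅B 1, B 0⁆ = 0)
      (h4 : ℓ ⁅B 2, B 0⁆ = 0) : ℓ = 0 := by
    have h5 : ℓ ⁅B 0, B 1⁆ = 0 := by rw [← lie_skew, map_neg, h3, neg_zero]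
    have h6 : ℓ ⁅B 0, B 2⁆ = 0 := by rw [← lie_skew, map_neg, h4, neg_zero]
    refine hperf ℓ fun x y => ?_
    have : (LieAlgebra.ad k g : g →ₗ[k] End k g).compr₂ ℓ = 0 := by
      refine B.ext fun i => B.ext fun j => ?_
      fin_cases i <;> fin_cases j <;> simp [h1, h3, h4, h5, h6, hhe, heh]
    exact LinearMap.congr_fun (LinearMap.congr_fun this x) y
  have hμ : μ ≠ 0 := by
    rintro rfl
    have := hvanish (B.coord 0) (by simp) (by simp [hhf]) (by simp [hef])
    simpa using LinearMap.congr_fun this (B 0)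
  have hd : d ≠ 0 := by
    rintro rfl
    have := hvanish (μ • B.coord 1 - α • B.coord 0) (by simp) (by simp [hhf, mul_comm])
      (by simp [hef])
    exact hμ (by simpa using LinearMap.congr_fun this (B 1))
  obtain rfl : μ = -2 := by
    have : (μ + 2) * d = 0 := by linear_combination -hj1
    exact eq_neg_of_add_eq_zero_left ((mul_eq_zero.mp this).resolve_right hd)
  obtain rfl : q = -α := by
    have : 2 * (q + α) = 0 := by linear_combination hj2
    exact eq_neg_of_add_eq_zero_left ((mul_eq_zero.mp this).resolve_left h2)
  have hef' : ⁅B 2, d⁻¹ • (B 0 - (α / 2) • B 1 - (β / 4) • B 2)⁆ = B 1 := by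
    rw [lie_smul, lie_sub, lie_sub, lie_smul, lie_smul, lie_self, hef, heh]
    match_scalars <;> field_simp <;> ring
  refine stronglyCancellative_of_sl2_triple hdim (B.ne_zero 1) hhe ?_ hef'
  rw [lie_smul, lie_sub, lie_sub, lie_smul, lie_smul, lie_self, hhf, hhe]
  match_scalars <;> field_simp
  ring

end Classification

end Cancel

/-- Over an algebraically closed field of characteristic zero, the universal enveloping
algebra of any 3-dimensional non-abelian Lie algebra is strongly cancellative. -/
theorem statement14 (k : Type u) [Field k] [IsAlgClosed k] [CharZero k]
    (g : Type u) [LieRing g] [LieAlgebra k g]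
    (hdim : Module.finrank k g = 3)
    (hnonab : ¬ ∀ x y : g, ⁅x, y⁆ = 0) :
    StronglyCancellative k (UniversalEnvelopingAlgebra k g) := by
  by_cases hperf : ∀ ℓ : g →ₗ[k] k, (∀ x y : g, ℓ ⁅x, y⁆ = 0) → ℓ = 0
  · exact Cancel.stronglyCancellative_of_perfect hdim hperf
  push Not at hperf
  obtain ⟨ℓ, hℓ, hℓ0⟩ := hperf
  by_cases hab : ∀ x y : g, ℓ x = 0 → ℓ y = 0 → ⁅x, y⁆ = 0
  · exact Cancel.stronglyCancellative_of_abelian_ker hdim hnonab hℓ0 hℓ hab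
  push Not at hab
  obtain ⟨x, y, hx, hy, hxy⟩ := hab
  exact Cancel.stronglyCancellative_of_nonabelian_ker hdim hℓ0 hℓ hx hy hxy
end

section
/- Let k be a field and let Z be a k-subalgebra of the polynomial ring k[t] that is graded with respect to the degree grading, i.e., for every p ∈ Z and every n ≥ 0 the monomial (coeff_n p)·t^n lies in Z. Then Z is a finitely generated k-algebra and a noetherian ring. -/
universe u

theorem Subalgebra.fg_of_forall_monomial_coeff_mem {k : Type*} [Field k]
    (Z : Subalgebra k (Polynomial k))
    (hgr : ∀ p ∈ Z, ∀ n : ℕ, Polynomial.monomial n (p.coeff n) ∈ Z) : Z.FG := by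
  let S : AddSubmonoid ℕ :=
    { carrier := {n | (Polynomial.X : Polynomial k) ^ n ∈ Z}
      zero_mem' := by simp
      add_mem' := fun {a b} ha hb => by
        simpa only [Set.mem_ofPred_eq, pow_add] using mul_mem ha hb }
  obtain ⟨G, hG⟩ := Nat.addSubmonoid_fg S
  have hGS : (G : Set ℕ) ⊆ S := hG ▸ AddSubmonoid.subset_closure
  classical
  refine ⟨G.image fun n => (Polynomial.X : Polynomial k) ^ n, le_antisymm ?_ fun p hp => ?_⟩
  · rw [Algebra.adjoin_le_iff, Finset.coe_image, Set.image_subset_iff]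
    exact hGS
  · have hpow {n : ℕ} (hn : n ∈ S) : (Polynomial.X : Polynomial k) ^ n ∈
        Algebra.adjoin k (G.image fun n => (Polynomial.X : Polynomial k) ^ n : Set _) := by
      rw [← hG] at hn
      induction hn using AddSubmonoid.closure_induction with
      | mem n hn =>
        exact Algebra.subset_adjoin (Finset.mem_coe.mpr (Finset.mem_image_of_mem _ hn))
      | zero => simp
      | add a b _ _ ha hb => simpa only [pow_add] using mul_mem ha hb
    rw [p.as_sum_support]
    refine sum_mem fun n hn => ?_
    have hc : p.coeff n ≠ 0 := Polynomial.mem_support_iff.mp hn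
    have hX : n ∈ S := by
      have h := Z.smul_mem (hgr p hp n) (p.coeff n)⁻¹
      rwa [Polynomial.smul_monomial, smul_eq_mul, inv_mul_cancel₀ hc,
        Polynomial.monomial_one_right_eq_X_pow] at h
    rw [← Polynomial.smul_X_eq_monomial]
    exact Subalgebra.smul_mem _ (hpow hX) _

/-- Let `Z` be a `k`-subalgebra of the polynomial ring `k[t]` that is graded with respect
to the degree grading, i.e. it contains each homogeneous component of each of its
elements. Then `Z` is a finitely generated `k`-algebra and a noetherian ring. -/
theorem statement15 (k : Type u) [Field k] (Z : Subalgebra k (Polynomial k))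
    (hgr : ∀ p ∈ Z, ∀ n : ℕ, (Polynomial.monomial n (p.coeff n)) ∈ Z) :
    Z.FG ∧ IsNoetherianRing Z := by
  have hfg := Z.fg_of_forall_monomial_coeff_mem hgr
  exact ⟨hfg, isNoetherianRing_of_fg hfg⟩
end

section
/- Let k be a field and let Z be a k-subalgebra of the polynomial ring k[t] that is graded with respect to the degree grading, i.e., for every p ∈ Z and every n ≥ 0 the monomial (coeff_n p)·t^n lies in Z. If Z is integrally closed in its field of fractions (i.e., Z is a normal domain) and Z contains a nonconstant polynomial, then Z is isomorphic to the polynomial ring k[u] in one variable as a k-algebra. -/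
open Polynomial in
/-- In an integrally closed subalgebra of `k[X]`, the exponents of the powers of `X` it contains
are closed under remainders. -/
theorem Subalgebra.X_pow_mod_mem {k : Type*} [Field k] (Z : Subalgebra k k[X])
    [IsIntegrallyClosed Z] {m n : ℕ} (hm0 : m ≠ 0) (hm : (X : k[X]) ^ m ∈ Z)
    (hn : (X : k[X]) ^ n ∈ Z) : (X : k[X]) ^ (n % m) ∈ Z := by
  set a : Z := ⟨X ^ m, hm⟩ with ha
  set b : Z := ⟨X ^ n, hn⟩ with hb
  have hdvd : (a ^ (n / m)) ^ m ∣ b ^ m := by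
    refine ⟨a ^ (n % m), Subtype.ext ?_⟩
    simp only [ha, hb, SubmonoidClass.coe_pow, ← pow_mul, ← pow_add]
    congr 1
    conv_lhs => rw [← Nat.div_add_mod n m]
    ring
  obtain ⟨c, hc⟩ := (IsIntegrallyClosed.pow_dvd_pow_iff hm0).mp hdvd
  have hc' : (X : k[X]) ^ n = X ^ (m * (n / m)) * (c : k[X]) := by
    simpa [ha, hb, ← pow_mul] using congrArg Subtype.val hc
  have hX : (X : k[X]) ^ (n % m) = c := by
    apply mul_left_cancel₀ (pow_ne_zero (m * (n / m)) (X_ne_zero (R := k)))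
    rw [← hc', ← pow_add, Nat.div_add_mod]
  exact hX ▸ c.2

open Polynomial in
/-- A polynomial whose exponents are all multiples of `m` is a polynomial in `X ^ m`. -/
theorem Polynomial.expand_contract_of_dvd {R : Type*} [CommSemiring R] {m : ℕ} (hm : m ≠ 0)
    {p : R[X]} (hp : ∀ n, p.coeff n ≠ 0 → m ∣ n) : expand R m (contract m p) = p := by
  ext n
  rw [coeff_expand (Nat.pos_of_ne_zero hm)]
  split_ifs with h
  · rw [coeff_contract hm, Nat.div_mul_cancel h]
  · by_contra hne
    exact h (hp n (Ne.symm hne))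

/-- Let `Z` be a `k`-subalgebra of the polynomial ring `k[t]` that is graded with respect
to the degree grading, i.e. it contains each homogeneous component of each of its
elements. If `Z` is integrally closed in its field of fractions (i.e. `Z` is a normal
domain) and contains a nonconstant polynomial, then `Z` is isomorphic to the polynomial
ring in one variable as a `k`-algebra. -/
theorem statement16 (k : Type u) [Field k] (Z : Subalgebra k (Polynomial k))
    (hgr : ∀ p ∈ Z, ∀ n : ℕ, (Polynomial.monomial n (p.coeff n)) ∈ Z)
    (hnormal : IsIntegrallyClosed Z)
    (hnonconst : ∃ p ∈ Z, 1 ≤ p.natDegree) :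
    Nonempty (Z ≃ₐ[k] Polynomial k) := by
  classical
  have hX : ∀ p ∈ Z, ∀ n, p.coeff n ≠ 0 → (Polynomial.X : Polynomial k) ^ n ∈ Z := by
    intro p hp n hn
    have h := Z.smul_mem (hgr p hp n) (p.coeff n)⁻¹
    rwa [Polynomial.smul_monomial, smul_eq_mul, inv_mul_cancel₀ hn,
      Polynomial.monomial_one_right_eq_X_pow] at h
  have hex : ∃ n, n ≠ 0 ∧ (Polynomial.X : Polynomial k) ^ n ∈ Z := by
    obtain ⟨p, hp, hdeg⟩ := hnonconst
    refine ⟨p.natDegree, by omega, hX p hp _ ?_⟩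
    rw [Polynomial.coeff_natDegree, Polynomial.leadingCoeff_ne_zero]
    rintro rfl
    simp at hdeg
  obtain ⟨hm0, hm⟩ := Nat.find_spec hex
  have hmin := fun r => Nat.find_min (m := r) hex
  generalize Nat.find hex = m at hm0 hm hmin
  have hdvd : ∀ n, (Polynomial.X : Polynomial k) ^ n ∈ Z → m ∣ n := by
    intro n hn
    by_contra h
    exact hmin (n % m) (Nat.mod_lt n (Nat.pos_of_ne_zero hm0))
      ⟨fun h0 => h (Nat.dvd_of_mod_eq_zero h0), Z.X_pow_mod_mem hm0 hm hn⟩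
  have hrange : (Polynomial.expand k m).range = Z := by
    ext p
    constructor
    · rintro ⟨q, rfl⟩
      change Polynomial.expand k m q ∈ Z
      rw [Polynomial.expand_eq_sum]
      exact Z.sum_mem fun i _ => Z.mul_mem (Z.algebraMap_mem _) (Z.pow_mem hm i)
    · intro hp
      exact ⟨_, Polynomial.expand_contract_of_dvd hm0 fun n hn => hdvd n (hX p hp n hn)⟩
  exact ⟨(Subalgebra.equivOfEq _ _ hrange.symm).trans
    (AlgEquiv.ofInjective (Polynomial.expand k m)
      (Polynomial.expand_injective (Nat.pos_of_ne_zero hm0))).symm⟩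
end

section
/- Let k be a field of characteristic zero and let L be a Lie algebra over k of dimension 2 that is not abelian. Then the center of the universal enveloping algebra U(L) is trivial, i.e., Z(U(L)) = k·1. -/
universe u

open Polynomial

attribute [local instance] LieRing.ofAssociativeRing

/-- A 2-dimensional non-abelian Lie algebra has a basis `x, y` with `⁅x, y⁆ = y`. -/
theorem exists_basis_lie_eq_of_finrank_eq_two {k L : Type*} [Field k] [LieRing L] [LieAlgebra k L]
    (hdim : Module.finrank k L = 2) (hnonab : ¬ ∀ x y : L, ⁅x, y⁆ = 0) :
    ∃ b : Module.Basis (Fin 2) k L, ⁅b 0, b 1⁆ = b 1 := by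
  have hbasis (x y : L) (h : ⁅x, y⁆ ≠ 0) :
      ∃ b : Module.Basis (Fin 2) k L, b 0 = x ∧ b 1 = y := by
    have hli : LinearIndependent k ![x, y] := by
      rw [LinearIndependent.pair_iff]
      intro s t hst
      have h₁ : s • ⁅x, y⁆ = 0 := by simpa using congrArg (fun z => ⁅z, y⁆) hst
      have h₂ : t • ⁅x, y⁆ = 0 := by simpa using congrArg (fun z => ⁅x, z⁆) hst
      exact ⟨(smul_eq_zero.mp h₁).resolve_right h, (smul_eq_zero.mp h₂).resolve_right h⟩
    exact ⟨basisOfLinearIndependentOfCardEqFinrank hli (by simp [hdim]), by simp, by simp⟩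
  push Not at hnonab
  obtain ⟨v, w, hvw⟩ := hnonab
  obtain ⟨b, rfl, rfl⟩ := hbasis v w hvw
  set y := ⁅b 0, b 1⁆ with hy
  obtain ⟨s, t, hst⟩ : ∃ s t : k, y = s • b 0 + t • b 1 :=
    ⟨b.repr y 0, b.repr y 1, by rw [← Fin.sum_univ_two fun i => b.repr y i • b i, b.sum_repr]⟩
  obtain ⟨x, hx⟩ : ∃ x : L, ⁅x, y⁆ = y := by
    by_cases hs : s = 0
    · have ht : t ≠ 0 := by
        rintro rfl
        exact hvw (by simpa [hs] using hst)
      refine ⟨t⁻¹ • b 0, ?_⟩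
      have h : ⁅b 0, y⁆ = t • y := by
        conv_lhs => rw [hst]
        simp [← hy]
      rw [smul_lie, h, smul_smul, inv_mul_cancel₀ ht, one_smul]
    · refine ⟨-(s⁻¹ • b 1), ?_⟩
      have h : ⁅y, b 1⁆ = s • y := by
        conv_lhs => rw [hst]
        simp [← hy]
      rw [neg_lie, smul_lie, ← lie_skew, h, smul_neg, neg_neg, smul_smul, inv_mul_cancel₀ hs,
        one_smul]
  obtain ⟨c, h₀, h₁⟩ := hbasis x y (by rwa [hx])
  exact ⟨c, by rw [h₀, h₁, hx]⟩

/-- A polynomial over a field of characteristic zero that is invariant under `X ↦ X + 1`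
is constant. -/
theorem Polynomial.eq_C_of_comp_X_add_one_eq {k : Type*} [Field k] [CharZero k] {f : k[X]}
    (hf : f.comp (X + 1) = f) : f = C (f.eval 0) := by
  have heval (n : ℕ) : f.eval (n : k) = f.eval 0 := by
    induction n with
    | zero => simp
    | succ n ih =>
      rw [← ih]
      conv_rhs => rw [← hf]
      simp
  refine eq_of_infinite_eval_eq _ _ ((Set.infinite_range_of_injective
    (Nat.cast_injective (R := k))).mono ?_)
  rintro _ ⟨n, rfl⟩
  simp [heval]

namespace UniversalEnvelopingAlgebra

/-- A subalgebra of the enveloping algebra containing the image of the Lie algebra is everything. -/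
theorem eq_top_of_ι_mem {k L : Type*} [CommRing k] [LieRing L] [LieAlgebra k L]
    (S : Subalgebra k (UniversalEnvelopingAlgebra k L)) (hS : ∀ l, ι k l ∈ S) : S = ⊤ := by
  let g : L →ₗ⁅k⁆ S :=
    { (ι k : L →ₗ⁅k⁆ UniversalEnvelopingAlgebra k L).toLinearMap.codRestrict S.toSubmodule hS with
      map_lie' := by
        intro x y
        apply Subtype.ext
        exact LieHom.map_lie (ι k) x y }
  have h : S.val.comp (lift k g) = AlgHom.id k _ := by
    ext l
    change ((lift k g (ι k l) : S) : UniversalEnvelopingAlgebra k L) = ι k l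
    rw [lift_ι_apply]
    rfl
  refine eq_top_iff.mpr fun u _ => ?_
  have hu := DFunLike.congr_fun h u
  rw [AlgHom.id_apply] at hu
  exact hu ▸ (lift k g u).2

end UniversalEnvelopingAlgebra

section NonabelianTwoDim

variable {k L : Type*} [Field k] [LieRing L] [LieAlgebra k L]

/-- The operator `X + Y ∂/∂Y` on `k[X][Y]`. -/
noncomputable def eulerShift (k : Type*) [Field k] : Module.End k[X] k[X][X] :=
  (X : k[X]) • 1 + LinearMap.mulLeft k[X] (X : k[X][X]) * derivative

theorem eulerShift_apply (p : k[X][X]) : eulerShift k p = (X : k[X]) • p + X * derivative p := rfl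

theorem eulerShift_monomial (n : ℕ) (f : k[X]) :
    eulerShift k (monomial n f) = monomial n ((X + (n : k[X])) * f) := by
  rw [eulerShift_apply, smul_monomial, smul_eq_mul, derivative_monomial]
  rcases n with _ | n
  · simp
  · rw [X_mul_monomial, add_tsub_cancel_right, ← map_add]
    congr 1
    ring

theorem eulerShift_mul_mulLeft_X :
    eulerShift k * LinearMap.mulLeft k[X] (X : k[X][X]) =
      LinearMap.mulLeft k[X] (X : k[X][X]) * eulerShift k + LinearMap.mulLeft k[X] (X : k[X][X]) := by
  refine LinearMap.ext fun p => ?_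
  simp only [LinearMap.add_apply, Module.End.mul_apply, LinearMap.mulLeft_apply, eulerShift_apply,
    derivative_mul, derivative_X, smul_eq_C_mul]
  ring

/-- A pair `x, y` in an associative algebra with `x * y = y * x + y` defines a representation of the
Lie algebra with `⁅b 0, b 1⁆ = b 1`. -/
noncomputable def lieHomOfMulEq (b : Module.Basis (Fin 2) k L) (hb : ⁅b 0, b 1⁆ = b 1)
    {A : Type*} [Ring A] [Algebra k A] {x y : A} (h : x * y = y * x + y) : L →ₗ⁅k⁆ A :=
  { b.constr k ![x, y] with
    map_lie' := by
      intro u v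
      have hb' : ⁅b 1, b 0⁆ = -b 1 := by rw [← lie_skew, hb]
      rw [← b.sum_repr u, ← b.sum_repr v]
      simp only [Fin.sum_univ_two, AddHom.toFun_eq_coe, LinearMap.coe_toAddHom, add_lie, lie_add,
        smul_lie, lie_smul, lie_self, hb, hb', map_add, map_smul, map_neg, map_zero,
        Module.Basis.constr_basis, Matrix.cons_val_zero, Matrix.cons_val_one,
        LieRing.of_associative_ring_bracket, mul_add, add_mul, smul_mul_assoc, mul_smul_comm, h]
      module }

/-- The representation of the Lie algebra with `⁅b 0, b 1⁆ = b 1` on `k[X][Y]` in which `b 0` acts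
by `X + Y ∂/∂Y` and `b 1` acts by multiplication by `Y`. -/
noncomputable def polynomialRep (b : Module.Basis (Fin 2) k L) (hb : ⁅b 0, b 1⁆ = b 1) :
    L →ₗ⁅k⁆ Module.End k[X] k[X][X] :=
  lieHomOfMulEq b hb eulerShift_mul_mulLeft_X

theorem polynomialRep_zero (b : Module.Basis (Fin 2) k L) (hb : ⁅b 0, b 1⁆ = b 1) :
    polynomialRep b hb (b 0) = eulerShift k :=
  b.constr_basis k _ 0

theorem polynomialRep_one (b : Module.Basis (Fin 2) k L) (hb : ⁅b 0, b 1⁆ = b 1) :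
    polynomialRep b hb (b 1) = LinearMap.mulLeft k[X] (X : k[X][X]) :=
  b.constr_basis k _ 1

/-- The linear map sending `Y ^ n f(X)` to `y ^ n f(x)`. -/
noncomputable def orderedEval {A : Type*} [Ring A] [Algebra k A] (x y : A) : k[X][X] →ₗ[k] A :=
  lsum fun n => LinearMap.mulLeft k (y ^ n) ∘ₗ (aeval x).toLinearMap

theorem orderedEval_monomial {A : Type*} [Ring A] [Algebra k A] (x y : A) (n : ℕ) (f : k[X]) :
    orderedEval x y (monomial n f) = y ^ n * aeval x f := by
  simp [orderedEval]

theorem mul_pow_of_mul_eq {A : Type*} [Ring A] {x y : A} (h : x * y = y * x + y) (n : ℕ) :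
    x * y ^ n = y ^ n * (x + n) := by
  induction n with
  | zero => simp
  | succ n ih =>
    rw [pow_succ, ← mul_assoc, ih, mul_assoc, add_mul, h, mul_assoc]
    congr 1
    push_cast
    rw [(Nat.cast_commute n y).eq]
    noncomm_ring

theorem orderedEval_eulerShift {A : Type*} [Ring A] [Algebra k A] {x y : A}
    (h : x * y = y * x + y) (p : k[X][X]) :
    orderedEval x y (eulerShift k p) = x * orderedEval x y p := by
  induction p using Polynomial.induction_on' with
  | add p q hp hq => simp only [map_add, hp, hq, mul_add]
  | monomial n f =>
    rw [eulerShift_monomial, orderedEval_monomial, orderedEval_monomial, ← mul_assoc,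
      mul_pow_of_mul_eq h, map_mul, map_add, aeval_X, map_natCast, mul_assoc]

theorem orderedEval_X_mul {A : Type*} [Ring A] [Algebra k A] (x y : A) (p : k[X][X]) :
    orderedEval x y (X * p) = y * orderedEval x y p := by
  induction p using Polynomial.induction_on' with
  | add p q hp hq => simp only [mul_add, map_add, hp, hq]
  | monomial n f =>
    rw [X_mul_monomial, orderedEval_monomial, orderedEval_monomial, pow_succ', mul_assoc]

open UniversalEnvelopingAlgebra in
theorem orderedEval_lift_polynomialRep (b : Module.Basis (Fin 2) k L) (hb : ⁅b 0, b 1⁆ = b 1)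
    (u : UniversalEnvelopingAlgebra k L) (p : k[X][X]) :
    orderedEval (ι k (b 0)) (ι k (b 1)) (lift k (polynomialRep b hb) u p) =
      u * orderedEval (ι k (b 0)) (ι k (b 1)) p := by
  let S : Subalgebra k (UniversalEnvelopingAlgebra k L) :=
    { carrier := {u | ∀ p, orderedEval (ι k (b 0)) (ι k (b 1)) (lift k (polynomialRep b hb) u p) =
        u * orderedEval (ι k (b 0)) (ι k (b 1)) p}
      mul_mem' := fun {u v} hu hv p => by
        rw [map_mul, Module.End.mul_apply, hu, hv, mul_assoc]
      add_mem' := fun {u v} hu hv p => by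
        rw [map_add, LinearMap.add_apply, map_add, hu, hv, add_mul]
      algebraMap_mem' := fun r p => by
        rw [AlgHom.commutes, Module.algebraMap_end_apply, map_smul, Algebra.smul_def] }
  have h : (ι k (b 0)) * (ι k (b 1)) = (ι k (b 1)) * (ι k (b 0)) + ι k (b 1) := by
    have := LieHom.map_lie (ι k) (b 0) (b 1)
    rw [hb, LieRing.of_associative_ring_bracket] at this
    rw [add_comm, eq_sub_iff_add_eq.mp this]
  have h₀ : ι k (b 0) ∈ S := fun p => by
    rw [lift_ι_apply, polynomialRep_zero, orderedEval_eulerShift h]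
  have h₁ : ι k (b 1) ∈ S := fun p => by
    rw [lift_ι_apply, polynomialRep_one, LinearMap.mulLeft_apply, orderedEval_X_mul]
  have hS : S = ⊤ := by
    refine eq_top_of_ι_mem S fun l => ?_
    rw [← b.sum_repr l, Fin.sum_univ_two, map_add, map_smul, map_smul]
    exact S.add_mem (S.smul_mem h₀ _) (S.smul_mem h₁ _)
  exact (hS ▸ Algebra.mem_top : u ∈ S) p

theorem aeval_eulerShift_X (f : k[X]) :
    aeval (eulerShift k) f (X : k[X][X]) = C (f.comp (X + 1)) * X := by
  have hX : eulerShift k (X : k[X][X]) = C (X + 1 : k[X]) * X := by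
    rw [eulerShift_apply, derivative_X, smul_eq_C_mul, map_add, map_one]
    ring
  induction f using Polynomial.induction_on with
  | C a =>
    rw [aeval_C, Module.algebraMap_end_apply, C_comp, ← smul_eq_C_mul]
    exact (algebraMap_smul k[X] a (X : k[X][X])).symm
  | add p q hp hq => rw [map_add, LinearMap.add_apply, hp, hq, add_comp, map_add, add_mul]
  | monomial n a ih =>
    rw [pow_succ, ← mul_assoc, map_mul (aeval _) (C a * X ^ n), aeval_X, Module.End.mul_apply, hX,
      ← smul_eq_C_mul (X + 1), map_smul, ih, mul_comp (C a * X ^ n), X_comp, smul_eq_C_mul,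
      map_mul C]
    ring

end NonabelianTwoDim

open UniversalEnvelopingAlgebra in
/-- Over a field of characteristic zero, the center of the universal enveloping algebra
of a 2-dimensional non-abelian Lie algebra is trivial, i.e. it consists exactly of the
scalar multiples of the identity. -/
theorem statement18 (k : Type u) [Field k] [CharZero k]
    (L : Type u) [LieRing L] [LieAlgebra k L]
    (hdim : Module.finrank k L = 2)
    (hnonab : ¬ ∀ x y : L, ⁅x, y⁆ = 0) :
    Subalgebra.center k (UniversalEnvelopingAlgebra k L) = ⊥ := by
  obtain ⟨b, hb⟩ := exists_basis_lie_eq_of_finrank_eq_two hdim hnonab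
  refine eq_bot_iff.mpr fun z hz => ?_
  rw [Subalgebra.mem_center_iff] at hz
  set ρ := lift k (polynomialRep b hb) with hρ
  have hρ₀ : ρ (ι k (b 0)) = eulerShift k := by rw [hρ, lift_ι_apply, polynomialRep_zero]
  have hρ₁ : ρ (ι k (b 1)) = LinearMap.mulLeft k[X] (X : k[X][X]) := by
    rw [hρ, lift_ι_apply, polynomialRep_one]
  set p : k[X][X] := ρ z 1 with hp
  have hder : derivative p = 0 := by
    have h := congrArg (fun u => ρ u 1) (hz (ι k (b 0)))
    simp only [map_mul, Module.End.mul_apply, hρ₀, ← hp] at h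
    rw [eulerShift_apply, eulerShift_apply, derivative_one, mul_zero, add_zero, map_smul, ← hp,
      add_eq_left] at h
    exact (mul_eq_zero.mp h).resolve_left X_ne_zero
  obtain ⟨f, hf⟩ : ∃ f, p = C f :=
    ⟨_, eq_C_of_natDegree_eq_zero (derivative_eq_zero.mp hder)⟩
  have hzf : z = aeval (ι k (b 0)) f := by
    have h := orderedEval_lift_polynomialRep b hb z 1
    rw [← hρ, ← hp, hf, ← monomial_zero_left, orderedEval_monomial, ← C_1, ← monomial_zero_left,
      orderedEval_monomial, pow_zero, one_mul, one_mul, map_one, mul_one] at h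
    exact h.symm
  have hinv : f.comp (X + 1) = f := by
    have h := congrArg (fun u => ρ u 1) (hz (ι k (b 1)))
    simp only [map_mul, Module.End.mul_apply, hρ₁, ← hp, LinearMap.mulLeft_apply, mul_one] at h
    rw [hzf, ← aeval_algHom_apply, hρ₀, aeval_eulerShift_X, hf, mul_comm] at h
    exact (C_injective (mul_right_cancel₀ X_ne_zero h)).symm
  rw [hzf, eq_C_of_comp_X_add_one_eq hinv, aeval_C]
  exact Subalgebra.algebraMap_mem _ _
end

section
/- Let k be a field of characteristic zero and let g be a 3-dimensional Heisenberg Lie algebra over k, i.e., a Lie algebra of dimension 3 admitting a nonzero element z such that the derived subalgebra [g,g] and the center of g both equal the one-dimensional span of z. Then the center of the universal enveloping algebra U(g) is the k-subalgebra generated by the image ι(z) of z in U(g), the element ι(z) is transcendental over k (so Z(U(g)) ≅ k[t]), and ι(z) lies in the two-sided ideal of U(g) generated by all commutators ab − ba. -/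
universe u

/-- The two-sided ideal `[A,A]` of `A` generated by all commutators `a*b - b*a`. -/
def commutatorIdeal (A : Type u) [Ring A] : TwoSidedIdeal A :=
  TwoSidedIdeal.span {x : A | ∃ a b : A, x = a * b - b * a}

namespace Heisenberg

open Polynomial

/-- The algebra map `k[t][s] → A` sending `t` to `z` and `s` to `y`, for commuting `y` and `z`. -/
noncomputable def bivariateEval {k A : Type*} [Field k] [Ring A] [Algebra k A] {y z : A}
    (h : Commute z y) : k[X][X] →+* A :=
  eval₂RingHom' (aeval z : k[X] →ₐ[k] A).toRingHom y fun p ↦ by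
    induction p using Polynomial.induction_on' with
    | add p q hp hq => simpa using hp.add_left hq
    | monomial n a =>
      simpa [aeval_monomial] using (Algebra.commute_algebraMap_left a y).mul_left (h.pow_left n)

section bivariateEval

variable {k A : Type*} [Field k] [Ring A] [Algebra k A] {x y z : A} (h : Commute z y)

@[simp]
lemma bivariateEval_C (p : k[X]) : bivariateEval h (C p) = aeval z p := by
  simp [bivariateEval]

@[simp]
lemma bivariateEval_X : bivariateEval (k := k) h X = y := by
  simp [bivariateEval]

lemma commute_aeval {w : A} (hw : Commute w z) (p : k[X]) : Commute w (aeval z p) := by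
  induction p using Polynomial.induction_on' with
  | add p q hp hq => simpa using hp.add_right hq
  | monomial n a =>
    simpa [aeval_monomial] using
      (Algebra.commute_algebraMap_right a w).mul_right (hw.pow_right n)

lemma mul_bivariateEval (hxz : Commute x z) (hxy : x * y - y * x = z) (f : k[X][X]) :
    x * bivariateEval h f =
      bivariateEval h f * x + bivariateEval h (C X * derivative f) := by
  have hxy' : x * y = y * x + z := by rw [← hxy]; abel
  induction f using Polynomial.induction_on with
  | C p => simpa using (commute_aeval hxz p).eq
  | add p q hp hq => simp only [map_add, mul_add, add_mul, hp, hq]; abel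
  | monomial n p ih =>
    set f := C p * X ^ n
    have hc : bivariateEval h f * z = bivariateEval h (C X * f) := by
      rw [mul_comm (C X) f, map_mul _ f, bivariateEval_C, aeval_X]
    have hd : C X * derivative (f * X) = C X * derivative f * X + C X * f := by
      rw [derivative_mul, derivative_X]; ring
    rw [pow_succ, ← mul_assoc, hd, map_mul, map_add, map_mul _ (C X * derivative f),
      bivariateEval_X, ← mul_assoc, ih, ← hc, add_mul, mul_assoc, hxy']
    noncomm_ring

/-- Every element of an algebra generated by `x, y, z` satisfying the Heisenberg relations has
a normal form `∑ fᵢ(z, y) xⁱ`. -/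
lemma exists_eval₂_eq (hxz : Commute x z) (hxy : x * y - y * x = z)
    (htop : Algebra.adjoin k {x, y, z} = ⊤) (u : A) :
    ∃ q : k[X][X][X], eval₂ (bivariateEval h) x q = u := by
  have key : ∀ w ∈ Algebra.adjoin k {x, y, z}, ∀ q : k[X][X][X],
      ∃ r : k[X][X][X], eval₂ (bivariateEval h) x r = w * eval₂ (bivariateEval h) x q := by
    have hC (f : k[X][X]) (q : k[X][X][X]) :
        eval₂ (bivariateEval h) x (C f * q) =
          bivariateEval h f * eval₂ (bivariateEval h) x q := by
      induction q using Polynomial.induction_on' with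
      | add p q hp hq => simp only [mul_add, eval₂_add, hp, hq]
      | monomial n g => simp [C_mul_monomial, eval₂_monomial, mul_assoc]
    intro w hw
    induction hw using Algebra.adjoin_induction with
    | mem w hw =>
      intro q
      rcases hw with rfl | rfl | rfl
      · induction q using Polynomial.induction_on' with
        | add p q hp hq =>
          obtain ⟨r, hr⟩ := hp
          obtain ⟨r', hr'⟩ := hq
          exact ⟨r + r', by rw [eval₂_add, eval₂_add, mul_add, hr, hr']⟩
        | monomial n f =>
          refine ⟨monomial (n + 1) f + monomial n (C X * derivative f), ?_⟩
          rw [eval₂_add, eval₂_monomial, eval₂_monomial, eval₂_monomial, ← mul_assoc,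
            mul_bivariateEval h hxz hxy, pow_succ']
          noncomm_ring
      · exact ⟨C X * q, by rw [hC, bivariateEval_X]⟩
      · exact ⟨C (C X) * q, by rw [hC, bivariateEval_C, aeval_X]⟩
    | algebraMap a =>
      exact fun q ↦ ⟨C (C (C a)) * q, by rw [hC, bivariateEval_C, aeval_C]⟩
    | add u v _ _ hu hv =>
      intro q
      obtain ⟨r, hr⟩ := hu q
      obtain ⟨r', hr'⟩ := hv q
      exact ⟨r + r', by rw [eval₂_add, add_mul, hr, hr']⟩
    | mul u v _ _ hu hv =>
      intro q
      obtain ⟨r, hr⟩ := hv q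
      obtain ⟨r', hr'⟩ := hu r
      exact ⟨r', by rw [hr', hr, mul_assoc]⟩
  simpa using key u (htop ▸ Algebra.mem_top) 1

end bivariateEval

section Representation

variable (k : Type*) [Field k]

/-- The operator `t ∂/∂s` on `k[t][s]`. -/
noncomputable def scaledDerivative : Module.End k k[X][X] :=
  Algebra.lmul k k[X][X] (C X) * (derivative (R := k[X])).restrictScalars k

@[simp]
lemma scaledDerivative_apply (f : k[X][X]) :
    scaledDerivative k f = C X * derivative f := rfl

lemma scaledDerivative_pow_apply (n : ℕ) (f : k[X][X]) :
    (scaledDerivative k ^ n) f = C X ^ n * derivative^[n] f := by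
  induction n with
  | zero => simp
  | succ n ih =>
    rw [pow_succ', Module.End.mul_apply, ih, scaledDerivative_apply, ← C_pow,
      derivative_C_mul, Function.iterate_succ_apply', ← mul_assoc, ← C_mul, ← pow_succ', C_pow]

variable {k} {A : Type*} [Ring A] [Algebra k A] {x y z : A} (h : Commute z y)
  (ρ : A →ₐ[k] Module.End k k[X][X])

lemma map_bivariateEval (hy : ρ y = Algebra.lmul k k[X][X] X)
    (hz : ρ z = Algebra.lmul k k[X][X] (C X)) (f : k[X][X]) :
    ρ (bivariateEval h f) = Algebra.lmul k k[X][X] f := by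
  have : (ρ : A →+* Module.End k k[X][X]).comp (bivariateEval h) =
      (Algebra.lmul k k[X][X] : k[X][X] →+* Module.End k k[X][X]) := by
    apply Polynomial.ringHom_ext
    · intro p
      have : ρ.comp (aeval z) =
          (Algebra.lmul k k[X][X]).comp (CAlgHom : k[X] →ₐ[k] k[X][X]) := by
        ext1
        simpa using hz
      simpa using DFunLike.congr_fun this p
    · simpa using hy
  exact DFunLike.congr_fun this f

lemma map_eval₂_injective [CharZero k] (hx : ρ x = scaledDerivative k)
    (hy : ρ y = Algebra.lmul k k[X][X] X) (hz : ρ z = Algebra.lmul k k[X][X] (C X))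
    (q : k[X][X][X]) (hq : ρ (eval₂ (bivariateEval h) x q) = 0) : q = 0 := by
  ext1 n
  induction n using Nat.strong_induction_on with
  | _ n ih =>
    have h0 := DFunLike.congr_fun hq (X ^ n)
    rw [eval₂_eq_sum_range, map_sum, LinearMap.sum_apply, Finset.sum_eq_single n] at h0
    · simpa [map_bivariateEval h ρ hy hz, hx, scaledDerivative_pow_apply,
        iterate_derivative_X_pow_eq_natCast_mul, Nat.descFactorial_self,
        Nat.factorial_ne_zero] using h0
    · intro b _ hb
      rcases lt_or_gt_of_ne hb with hb | hb
      · simp [ih b hb]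
      · rw [map_mul ρ, map_pow ρ, hx, Module.End.mul_apply, scaledDerivative_pow_apply,
          iterate_derivative_eq_zero (by simpa using hb)]
        simp
    · intro hn
      simp [coeff_eq_zero_of_natDegree_lt (by simpa using hn)]

lemma aeval_mulLeft_C_X (p : k[X]) :
    aeval (Algebra.lmul k k[X][X] (C X)) p = Algebra.lmul k k[X][X] (C p) := by
  have : aeval (C X : k[X][X]) p = C p := by
    have h := aeval_algHom_apply (CAlgHom : k[X] →ₐ[k] k[X][X]) X p
    simpa using h
  rw [aeval_algHom_apply, this]

lemma transcendental_of_map (hz : ρ z = Algebra.lmul k k[X][X] (C X)) :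
    Transcendental k z := by
  rw [transcendental_iff]
  intro p hp
  have h := congrArg ρ hp
  rw [← aeval_algHom_apply, hz, aeval_mulLeft_C_X, map_zero] at h
  simpa using DFunLike.congr_fun h 1

/-- The center of an algebra generated by `x, y, z` satisfying the Heisenberg relations and
acting on `k[t][s]` in the standard way is generated by `z`. -/
lemma center_eq_adjoin [CharZero k] (hxz : Commute x z) (hyz : Commute y z)
    (hxy : x * y - y * x = z) (htop : Algebra.adjoin k {x, y, z} = ⊤)
    (hx : ρ x = scaledDerivative k) (hy : ρ y = Algebra.lmul k k[X][X] X)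
    (hz : ρ z = Algebra.lmul k k[X][X] (C X)) :
    Subalgebra.center k A = Algebra.adjoin k {z} := by
  have h : Commute z y := hyz.symm
  apply le_antisymm
  · intro u hu
    rw [Subalgebra.mem_center_iff] at hu
    have hcomm (w : A) (f : k[X][X]) : ρ w (ρ u f) = ρ u (ρ w f) := by
      rw [← Module.End.mul_apply, ← map_mul, hu, map_mul, Module.End.mul_apply]
    have hmul (f : k[X][X]) : ρ u f = f * ρ u 1 := by
      simpa [map_bivariateEval h ρ hy hz] using (hcomm (bivariateEval h f) 1).symm
    have hder : derivative (ρ u 1) = 0 := by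
      simpa [hx] using hcomm x 1
    obtain ⟨p, hp⟩ : ∃ p, ρ u 1 = C p := ⟨_, eq_C_of_derivative_eq_zero hder⟩
    have hu0 : u = aeval z p := by
      obtain ⟨q, hq⟩ := exists_eval₂_eq h hxz hxy htop (u - aeval z p)
      have hq0 : q = 0 := by
        refine map_eval₂_injective h ρ hx hy hz q ?_
        rw [hq, map_sub, ← aeval_algHom_apply, hz, aeval_mulLeft_C_X]
        refine LinearMap.ext fun f ↦ ?_
        simp [hmul f, hp, mul_comm]
      rw [← sub_eq_zero, ← hq, hq0, eval₂_zero]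
    rw [hu0]
    exact aeval_mem_adjoin_singleton k z
  · rw [Algebra.adjoin_le_iff, Set.singleton_subset_iff, SetLike.mem_coe,
      Subalgebra.mem_center_iff]
    intro w
    have hw : w ∈ Algebra.adjoin k {x, y, z} := htop ▸ Algebra.mem_top
    have hle : Algebra.adjoin k {x, y, z} ≤ Subalgebra.centralizer k {z} := by
      simp [Algebra.adjoin_le_iff, Set.insert_subset_iff, Set.mem_centralizer_iff, hxz.eq, h.eq]
    exact (Subalgebra.mem_centralizer_iff k |>.mp (hle hw) z rfl).symm

end Representation

section LieAlgebra

attribute [local instance] LieRing.ofAssociativeRing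

variable {k g : Type*} [Field k] [LieRing g] [LieAlgebra k g] {z : g}

/-- The standard action of the Heisenberg Lie algebra on `k[t][s]`: with respect to a basis
`x, y, z` with `[x, y] = z` central, `x` acts as `t ∂/∂s`, `y` as `s` and `z` as `t`. -/
noncomputable def standardRep (b : Module.Basis (Fin 3) k g) (hxy : ⁅b 0, b 1⁆ = b 2)
    (hxz : ⁅b 0, b 2⁆ = 0) (hyz : ⁅b 1, b 2⁆ = 0) : g →ₗ⁅k⁆ Module.End k k[X][X] :=
  { b.constr k ![scaledDerivative k, Algebra.lmul k k[X][X] X, Algebra.lmul k k[X][X] (C X)] with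
    map_lie' := by
      intro v w
      have hyx : ⁅b 1, b 0⁆ = -b 2 := by rw [← lie_skew, hxy]
      have hzx : ⁅b 2, b 0⁆ = 0 := by rw [← lie_skew, hxz, neg_zero]
      have hzy : ⁅b 2, b 1⁆ = 0 := by rw [← lie_skew, hyz, neg_zero]
      rw [← b.sum_repr v, ← b.sum_repr w]
      simp only [Fin.sum_univ_three, AddHom.toFun_eq_coe, LinearMap.coe_toAddHom, lie_add,
        add_lie, smul_lie, lie_smul, lie_self, hxy, hxz, hyz, hyx, hzx, hzy, map_add, map_smul,
        map_neg, map_zero, Module.Basis.constr_basis]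
      ext f : 1
      simp [LieRing.of_associative_ring_bracket]
      simp only [Algebra.smul_def]
      ring }

lemma adjoin_ι_eq_top : Algebra.adjoin k (Set.range (UniversalEnvelopingAlgebra.ι k (L := g))) =
    (⊤ : Subalgebra k (UniversalEnvelopingAlgebra k g)) := by
  have hsurj : Function.Surjective (UniversalEnvelopingAlgebra.mkAlgHom k g) :=
    RingCon.mkₐ_surjective _
  have hrange : Set.range (UniversalEnvelopingAlgebra.ι k (L := g)) =
      UniversalEnvelopingAlgebra.mkAlgHom k g '' Set.range (TensorAlgebra.ι k) := by
    rw [← Set.range_comp]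
    rfl
  rw [hrange, ← AlgHom.map_adjoin, TensorAlgebra.adjoin_range_ι, Algebra.map_top,
    AlgHom.range_eq_top]
  exact hsurj

lemma adjoin_ι_basis_eq_top {n : Type*} (b : Module.Basis n k g) :
    Algebra.adjoin k (Set.range (UniversalEnvelopingAlgebra.ι k ∘ b)) =
      (⊤ : Subalgebra k (UniversalEnvelopingAlgebra k g)) := by
  rw [← top_le_iff, ← adjoin_ι_eq_top, Algebra.adjoin_le_iff]
  rintro _ ⟨v, rfl⟩
  apply Algebra.span_le_adjoin
  rw [Set.range_comp]
  have h := Submodule.apply_mem_span_image_of_mem_span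
    (UniversalEnvelopingAlgebra.ι k (L := g)).toLinearMap (b.mem_span v)
  exact h

lemma exists_basis_of_center_eq (hdim : Module.finrank k g = 3) (hz : z ≠ 0)
    (hder : (⁅(⊤ : LieIdeal k g), (⊤ : LieIdeal k g)⁆ : LieIdeal k g).toSubmodule =
      Submodule.span k {z})
    (hcen : (LieAlgebra.center k g).toSubmodule = Submodule.span k {z}) :
    ∃ b : Module.Basis (Fin 3) k g, b 2 = z ∧ ⁅b 0, b 1⁆ = z := by
  have hzc (v : g) : ⁅v, z⁆ = 0 := by
    have : z ∈ (LieAlgebra.center k g).toSubmodule := hcen ▸ Submodule.mem_span_singleton_self z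
    exact (LieModule.mem_maxTrivSubmodule k g g z).mp this v
  obtain ⟨x, y, hxy⟩ : ∃ x y : g, ⁅x, y⁆ ≠ 0 := by
    by_contra! h
    have h0 : ⁅(⊤ : LieIdeal k g), (⊤ : LieIdeal k g)⁆ = ⊥ :=
      LieSubmodule.lie_eq_bot_iff _ _ |>.mpr fun x _ m _ ↦ h x m
    rw [h0, LieSubmodule.bot_toSubmodule] at hder
    exact hz (Submodule.span_singleton_eq_bot.mp hder.symm)
  obtain ⟨c, hc⟩ : ∃ c : k, c • z = ⁅x, y⁆ := by
    rw [← Submodule.mem_span_singleton, ← hder]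
    exact LieSubmodule.lie_mem_lie (LieSubmodule.mem_top x) (LieSubmodule.mem_top y)
  have hc0 : c ≠ 0 := by
    rintro rfl
    exact hxy (by rw [← hc, zero_smul])
  have hxy' : ⁅c⁻¹ • x, y⁆ = z := by rw [smul_lie, ← hc, inv_smul_smul₀ hc0]
  generalize c⁻¹ • x = x at hxy'
  have hyx : ⁅y, x⁆ = -z := by rw [← lie_skew, hxy']
  have hli : LinearIndependent k ![x, y, z] := by
    rw [Fintype.linearIndependent_iff]
    intro a ha
    simp only [Fin.sum_univ_three, Matrix.cons_val] at ha
    have h0 : a 0 = 0 := by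
      simpa [hyx, hzc, hz] using congrArg (⁅y, ·⁆) ha
    have h1 : a 1 = 0 := by
      simpa [hxy', hzc, hz] using congrArg (⁅x, ·⁆) ha
    have h2 : a 2 = 0 := by simpa [h0, h1, hz] using ha
    intro i
    fin_cases i <;> assumption
  refine ⟨basisOfLinearIndependentOfCardEqFinrank hli (by simp [hdim]), ?_, ?_⟩ <;> simp [hxy']

lemma exists_algHom_of_basis (b : Module.Basis (Fin 3) k g) (hxy : ⁅b 0, b 1⁆ = b 2)
    (hxz : ⁅b 0, b 2⁆ = 0) (hyz : ⁅b 1, b 2⁆ = 0) :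
    ∃ ρ : UniversalEnvelopingAlgebra k g →ₐ[k] Module.End k k[X][X],
      ρ (UniversalEnvelopingAlgebra.ι k (b 0)) = scaledDerivative k ∧
      ρ (UniversalEnvelopingAlgebra.ι k (b 1)) = Algebra.lmul k k[X][X] X ∧
      ρ (UniversalEnvelopingAlgebra.ι k (b 2)) = Algebra.lmul k k[X][X] (C X) := by
  have key (i : Fin 3) : standardRep b hxy hxz hyz (b i) = _ := b.constr_basis k _ i
  refine ⟨UniversalEnvelopingAlgebra.lift k (standardRep b hxy hxz hyz), ?_, ?_, ?_⟩ <;>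
    rw [UniversalEnvelopingAlgebra.lift_ι_apply, key] <;> rfl

lemma ι_lie_eq (v w : g) :
    UniversalEnvelopingAlgebra.ι k ⁅v, w⁆ =
      UniversalEnvelopingAlgebra.ι k v * UniversalEnvelopingAlgebra.ι k w -
        UniversalEnvelopingAlgebra.ι k w * UniversalEnvelopingAlgebra.ι k v := by
  rw [LieHom.map_lie, LieRing.of_associative_ring_bracket]

lemma commute_ι_of_lie_eq_zero {v w : g} (h : ⁅v, w⁆ = 0) :
    Commute (UniversalEnvelopingAlgebra.ι k v) (UniversalEnvelopingAlgebra.ι k w) := by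
  rw [commute_iff_eq, ← sub_eq_zero, ← ι_lie_eq, h, map_zero]

end LieAlgebra

end Heisenberg

/-- Let `k` be a field of characteristic zero and let `g` be a 3-dimensional Heisenberg
Lie algebra over `k`, i.e. a Lie algebra of dimension 3 with a nonzero element `z` such
that the derived subalgebra `[g,g]` and the center of `g` both equal the one-dimensional
span of `z`. Then the center of `U(g)` is the `k`-subalgebra generated by the image
`ι(z)` of `z`, the element `ι(z)` is transcendental over `k` (so `Z(U(g)) ≅ k[t]`), and
`ι(z)` lies in the two-sided ideal of `U(g)` generated by all commutators. -/
theorem statement19 (k : Type u) [Field k] [CharZero k]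
    (g : Type u) [LieRing g] [LieAlgebra k g]
    (hdim : Module.finrank k g = 3)
    (z : g) (hz : z ≠ 0)
    (hder : (⁅(⊤ : LieIdeal k g), (⊤ : LieIdeal k g)⁆ : LieIdeal k g).toSubmodule =
      Submodule.span k {z})
    (hcen : (LieAlgebra.center k g).toSubmodule = Submodule.span k {z}) :
    Subalgebra.center k (UniversalEnvelopingAlgebra k g) =
        Algebra.adjoin k {UniversalEnvelopingAlgebra.ι k z} ∧
      Transcendental k (UniversalEnvelopingAlgebra.ι k z) ∧
      UniversalEnvelopingAlgebra.ι k z ∈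
        commutatorIdeal (UniversalEnvelopingAlgebra k g) := by
  obtain ⟨b, rfl, hxy⟩ := Heisenberg.exists_basis_of_center_eq hdim hz hder hcen
  have hlie (v : g) : ⁅v, b 2⁆ = 0 := by
    have : b 2 ∈ (LieAlgebra.center k g).toSubmodule :=
      hcen ▸ Submodule.mem_span_singleton_self (b 2)
    exact (LieModule.mem_maxTrivSubmodule k g g (b 2)).mp this v
  obtain ⟨ρ, hρx, hρy, hρz⟩ := Heisenberg.exists_algHom_of_basis b hxy (hlie _) (hlie _)
  have hcomm : UniversalEnvelopingAlgebra.ι k (b 2) = _ := hxy ▸ Heisenberg.ι_lie_eq (b 0) (b 1)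
  have htop : Algebra.adjoin k {UniversalEnvelopingAlgebra.ι k (b 0),
      UniversalEnvelopingAlgebra.ι k (b 1), UniversalEnvelopingAlgebra.ι k (b 2)} = ⊤ := by
    rw [← Heisenberg.adjoin_ι_basis_eq_top b]
    congr 1
    ext u
    simp [Fin.exists_fin_succ, eq_comm]
  refine ⟨Heisenberg.center_eq_adjoin ρ (Heisenberg.commute_ι_of_lie_eq_zero (hlie _))
    (Heisenberg.commute_ι_of_lie_eq_zero (hlie _)) hcomm.symm htop hρx hρy hρz,
    Heisenberg.transcendental_of_map ρ hρz, ?_⟩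
  exact TwoSidedIdeal.subset_span ⟨_, _, hcomm⟩
end
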